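/- arXiv:2106.09796 — 2 statements merged into one kernel-verified Lean document; each statement's English description precedes it below -/
import Mathlib

section
/- (Sharp; Enescu–Hochster) Let (A,m,k) be a commutative Noetherian local ring of prime characteristic p, let M be an Artinian A-module, and let f : M → M be a Frobenius action (an additive map with f(a z) = a^p f(z)) which is injective. Then M admits only finitely many special primes; that is, the set of prime ideals of A that arise as the annihilator of some A-submodule N ⊆ M with f(N) ⊆ N is finite. -/
namespace FrobeniusAction

variable {A M : Type*} [CommRing A] [AddCommGroup M] [Module A M]

/-- The submodule `N` is stable under the additive map `f`. -/
def IsStable (f : M →+ M) (N : Submodule A M) : Prop :=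
  ∀ z ∈ N, f z ∈ N

/-- An ideal is special for `f` if it is the annihilator of an `f`-stable submodule. -/
def IsSpecial (f : M →+ M) (I : Ideal A) : Prop :=
  ∃ N : Submodule A M, IsStable f N ∧ I = N.annihilator

variable {f : M →+ M} {p : ℕ}

theorem IsStable.inf {N N' : Submodule A M} (h : IsStable f N) (h' : IsStable f N') :
    IsStable f (N ⊓ N') :=
  fun z hz ↦ ⟨h z hz.1, h' z hz.2⟩

theorem IsStable.iSup {ι : Sort*} {N : ι → Submodule A M} (h : ∀ i, IsStable f (N i)) :
    IsStable f (⨆ i, N i) := by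
  intro z hz
  induction hz using Submodule.iSup_induction' with
  | mem i x hx => exact Submodule.mem_iSup_of_mem i (h i x hx)
  | zero => simp
  | add x y _ _ hx hy => simpa using add_mem hx hy

theorem IsStable.map_lsmul (hf : ∀ (a : A) (z : M), f (a • z) = a ^ p • f z) (hp : p ≠ 0)
    {N : Submodule A M} (h : IsStable f N) (a : A) :
    IsStable f (N.map (LinearMap.lsmul A M a)) := by
  rintro _ ⟨z, hz, rfl⟩
  refine ⟨a ^ (p - 1) • f z, N.smul_mem _ (h z hz), ?_⟩
  simp [hf, smul_smul, pow_sub_one_mul hp]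

theorem IsSpecial.colon (hf : ∀ (a : A) (z : M), f (a • z) = a ^ p • f z) (hp : p ≠ 0)
    {I : Ideal A} (h : IsSpecial f I) (a : A) :
    IsSpecial f (Submodule.colon I {a}) := by
  obtain ⟨N, hN, rfl⟩ := h
  refine ⟨_, hN.map_lsmul hf hp a, ?_⟩
  ext r
  simp [Submodule.mem_colon_singleton, Submodule.mem_annihilator, mul_smul]

theorem IsSpecial.isRadical (hf : ∀ (a : A) (z : M), f (a • z) = a ^ p • f z) (hp : 1 < p)
    (hinj : Function.Injective f) {I : Ideal A} (h : IsSpecial f I) : I.IsRadical := by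
  obtain ⟨N, hN, rfl⟩ := h
  refine (Ideal.isRadical_iff_pow_one_lt p hp).2 fun a ha ↦ ?_
  rw [Submodule.mem_annihilator] at ha ⊢
  intro z hz
  apply hinj
  rw [hf, ha _ (hN z hz), map_zero]

theorem IsSpecial.of_mem_minimalPrimes [IsNoetherianRing A]
    (hf : ∀ (a : A) (z : M), f (a • z) = a ^ p • f z) (hp : p ≠ 0)
    {I q : Ideal A} (h : IsSpecial f I) (hq : q ∈ I.minimalPrimes) : IsSpecial f q := by
  have hI : Submodule.colon I {(1 : A)} = I := by
    ext r
    simp [Submodule.mem_colon_singleton]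
  obtain ⟨a, rfl⟩ := Submodule.exists_eq_colon_of_mem_minimalPrimes (hI.symm ▸ hq)
  exact h.colon hf hp a

/-- If finitely many special primes exist in heights above `n`, then finitely many exist in
height `n`. -/
theorem finite_special_height_eq [IsNoetherianRing A] [IsArtinian A M]
    (hf : ∀ (a : A) (z : M), f (a • z) = a ^ p • f z) (hp : 1 < p)
    (hinj : Function.Injective f) {n : ℕ∞}
    (hfin : {P : Ideal A | (P.IsPrime ∧ IsSpecial f P) ∧ n < P.height}.Finite) :
    {P : Ideal A | (P.IsPrime ∧ IsSpecial f P) ∧ P.height = n}.Finite := by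
  by_contra hinf
  set b : Ideal A := hfin.toFinset.inf id
  obtain ⟨P, hPinj, hP⟩ : ∃ P : ℕ → Ideal A, Function.Injective P ∧
      ∀ i, ((P i).IsPrime ∧ IsSpecial f (P i)) ∧ (P i).height = n :=
    ⟨_, Subtype.val_injective.comp (Set.Infinite.natEmbedding _ hinf).injective,
      fun i ↦ (Set.Infinite.natEmbedding _ hinf i).2⟩
  choose N hN hPN using fun i ↦ (hP i).1.2
  have hprime (i) : (P i).IsPrime := (hP i).1.1
  obtain ⟨k, hk⟩ := WellFoundedLT.antitone_chain_condition
    (f := fun k ↦ ⨆ i : {i // k ≤ i}, N i) fun k l hkl ↦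
      iSup_le fun i ↦ le_iSup_of_le ⟨i.1, hkl.trans i.2⟩ le_rfl
  have hbk : b ≤ P k := by
    intro c hc
    rw [hPN, Submodule.mem_annihilator]
    intro z hz
    have hz' : z ∈ ⨆ i : {i // k + 1 ≤ i}, N i := by
      rw [← hk (k + 1) k.le_succ]
      exact Submodule.mem_iSup_of_mem (p := fun i : {i // k ≤ i} ↦ N i) ⟨k, le_rfl⟩ hz
    obtain ⟨s, hs⟩ := (Submodule.mem_iSup_iff_exists_finset
      (p := fun i : {i // k + 1 ≤ i} ↦ N i)).1 hz'
    have hsup : IsStable f (⨆ i ∈ s, N i) :=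
      IsStable.iSup fun i ↦ IsStable.iSup fun _ ↦ hN i.1
    have hJ : IsSpecial f (N k ⊓ ⨆ i ∈ s, N i).annihilator :=
      ⟨_, (hN k).inf hsup, rfl⟩
    refine Submodule.mem_annihilator.1 (?_ : c ∈ (N k ⊓ ⨆ i ∈ s, N i).annihilator) z ⟨hz, hs⟩
    rw [← (hJ.isRadical hf hp hinj).radical, ← Ideal.sInf_minimalPrimes, Submodule.mem_sInf]
    intro (q : Ideal A) hq
    have hqp : q.IsPrime := hq.isPrime
    have hkq : P k ≤ q := by
      refine le_trans ?_ hq.le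
      rw [hPN]
      exact Submodule.annihilator_mono inf_le_left
    obtain ⟨i, -, hiq⟩ : ∃ i ∈ s, P i ≤ q := by
      refine hqp.inf_le'.1 (le_trans ?_ hq.le)
      refine le_trans ?_ (Submodule.annihilator_mono inf_le_right)
      simp only [Submodule.annihilator_iSup, le_iInf_iff]
      exact fun i hi ↦ (Finset.inf_le hi).trans (hPN i).le
    have hlt : P k < q := by
      refine lt_of_le_of_ne hkq fun h ↦ ?_
      have hik : P i = P k :=
        have := hprime i
        Ideal.eq_of_le_of_height_le _ (hiq.trans h.ge) ((hP k).2.trans (hP i).2.symm).le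
      have hki : k + 1 ≤ i.1 := i.2
      have := hPinj hik
      omega
    have hqmem : q ∈ hfin.toFinset := by
      rw [Set.Finite.mem_toFinset]
      exact ⟨⟨hqp, hJ.of_mem_minimalPrimes hf (by omega) hq⟩,
        (hP k).2 ▸ Ideal.height_strict_mono_of_isPrime hlt⟩
    exact Finset.inf_le (f := id) hqmem hc
  obtain ⟨q, hq, hqk⟩ := (hprime k).inf_le'.1 hbk
  rw [Set.Finite.mem_toFinset] at hq
  exact (hq.2.trans_le (Ideal.height_mono hqk)).ne (hP k).2.symm

theorem finite_special_primes [IsNoetherianRing A] [FiniteRingKrullDim A] [IsArtinian A M]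
    (hf : ∀ (a : A) (z : M), f (a • z) = a ^ p • f z) (hp : 1 < p)
    (hinj : Function.Injective f) :
    {P : Ideal A | P.IsPrime ∧ IsSpecial f P}.Finite := by
  obtain ⟨m, hm, hdim⟩ := Ideal.exists_isMaximal_height (R := A)
  obtain ⟨d, hd⟩ := ENat.ne_top_iff_exists.1 (m.height_ne_top hm.ne_top)
  have key : {P : Ideal A | (P.IsPrime ∧ IsSpecial f P) ∧ ((0 : ℕ) : ℕ∞) ≤ P.height}.Finite := by
    refine Nat.decreasingInduction
      (motive := fun k _ ↦
        {P : Ideal A | (P.IsPrime ∧ IsSpecial f P) ∧ (k : ℕ∞) ≤ P.height}.Finite)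
      (fun k _ ih ↦ ?_) ?_ (Nat.zero_le (d + 1))
    · have hlt : {P : Ideal A | (P.IsPrime ∧ IsSpecial f P) ∧ (k : ℕ∞) < P.height}.Finite :=
        ih.subset fun P hP ↦ ⟨hP.1, by simpa using Order.add_one_le_of_lt hP.2⟩
      refine ((finite_special_height_eq hf hp hinj hlt).union hlt).subset fun P hP ↦ ?_
      exact hP.2.eq_or_lt.imp (fun h ↦ ⟨hP.1, h.symm⟩) fun h ↦ ⟨hP.1, h⟩
    · convert Set.finite_empty
      refine Set.eq_empty_of_forall_notMem fun P hP ↦ ?_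
      have hprime : P.IsPrime := hP.1.1
      have hle : P.height ≤ d := by
        rw [hd, ← WithBot.coe_le_coe, hdim]
        exact Ideal.height_le_ringKrullDim_of_isPrime
      exact absurd (Nat.cast_le.1 (hP.2.trans hle)) (by omega)
  simpa using key

end FrobeniusAction

/-- **Sharp; Enescu–Hochster.** Let `(A, 𝔪, k)` be a Noetherian local ring of prime
characteristic `p`, `M` an Artinian `A`-module and `f : M → M` an injective Frobenius action
(an additive map with `f (a • z) = a^p • f z`).  Then the set of special primes of `M`, i.e.
primes of `A` arising as the annihilator of an `f`-stable `A`-submodule of `M`, is finite. -/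
theorem finiteness_of_special_primes
    (A : Type) [CommRing A] [IsNoetherianRing A] [IsLocalRing A]
    (p : ℕ) (hp : p.Prime) [CharP A p]
    (M : Type) [AddCommGroup M] [Module A M] [IsArtinian A M]
    (f : M →+ M) (hf : ∀ (a : A) (z : M), f (a • z) = a ^ p • f z)
    (hinj : Function.Injective f) :
    {P : Ideal A | P.IsPrime ∧
      ∃ N : Submodule A M, (∀ z ∈ N, f z ∈ N) ∧ P = N.annihilator}.Finite := by
  exact FrobeniusAction.finite_special_primes hf hp.one_lt hinj
end

section
/- (Hochster–Jeffries) Let (A,m) be a commutative Noetherian local domain of prime characteristic p, let I be an ideal of A, and let c = lcd_A(I) be the cohomological dimension of I. If c equals the arithmetic rank ara_A(I), then H^c_I(A) is a faithful A-module, i.e., Ann_A(H^c_I(A)) = 0. -/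
open CategoryTheory

universe u

/-- A tower of nonnegatively graded complexes with the same projective components, whose
differentials `D t` and transition maps `Φ m` (from level `t + m` to level `t`) are such that
the homology in positive degrees is pro-zero. -/
structure ProExactTower (A : Type u) [CommRing A] where
  X : ℕ → ModuleCat.{u} A
  D : ℕ → ∀ i, X (i + 1) →ₗ[A] X i
  Φ : ℕ → ∀ i, X i →ₗ[A] X i
  Φ_zero : ∀ i v, Φ 0 i v = v
  Φ_add : ∀ m n i v, Φ (m + n) i v = Φ m i (Φ n i v)
  Φ_deg_zero : ∀ m v, Φ m 0 v = v
  D_D : ∀ t i v, D t i (D t (i + 1) v) = 0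
  D_Φ : ∀ t m i v, D t i (Φ m (i + 1) v) = Φ m i (D (t + m) i v)
  proj : ∀ i, Module.Projective A (X i)
  pro : ∀ t, ∃ m, ∀ i v, D (t + m) i v = 0 → ∃ w, D t (i + 1) w = Φ m (i + 1) v

namespace ProExactTower

variable {A : Type u} [CommRing A]

/-- The linear form `g` on degree `n` is a coboundary. -/
def IsCob {X : ℕ → ModuleCat.{u} A} (d : ∀ i, X (i + 1) →ₗ[A] X i) :
    ∀ n, (X n →ₗ[A] A) → Prop
  | 0, g => g = 0
  | n + 1, g => ∃ h : X n →ₗ[A] A, g = h ∘ₗ d n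

section IsCob

variable {X Q : ℕ → ModuleCat.{u} A} {d : ∀ i, X (i + 1) →ₗ[A] X i}
  {dQ : ∀ i, Q (i + 1) →ₗ[A] Q i}

theorem IsCob.add {n : ℕ} {g g' : X n →ₗ[A] A} (h : IsCob d n g) (h' : IsCob d n g') :
    IsCob d n (g + g') := by
  cases n with
  | zero => change g = 0 at h; change g' = 0 at h'; change g + g' = 0; simp [h, h']
  | succ n =>
    obtain ⟨h, rfl⟩ := h
    obtain ⟨h', rfl⟩ := h'
    exact ⟨h + h', by rw [LinearMap.add_comp]⟩

theorem IsCob.smul {n : ℕ} {g : X n →ₗ[A] A} (h : IsCob d n g) (a : A) :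
    IsCob d n (a • g) := by
  cases n with
  | zero => change g = 0 at h; change a • g = 0; simp [h]
  | succ n =>
    obtain ⟨h, rfl⟩ := h
    exact ⟨a • h, by rw [LinearMap.smul_comp]⟩

theorem IsCob.comp {n : ℕ} {g : X n →ₗ[A] A} (h : IsCob d n g) (f : ∀ i, Q i →ₗ[A] X i)
    (hf : ∀ i < n, ∀ v, d i (f (i + 1) v) = f i (dQ i v)) : IsCob dQ n (g ∘ₗ f n) := by
  cases n with
  | zero => change g = 0 at h; change g ∘ₗ f 0 = 0; simp [h]
  | succ n =>
    obtain ⟨h, rfl⟩ := h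
    refine ⟨h ∘ₗ f n, ?_⟩
    ext v
    simp [hf n (Nat.lt_succ_self n)]

end IsCob

variable (T : ProExactTower A)

theorem exists_lift {Q M N : Type*} [AddCommGroup Q] [Module A Q] [Module.Projective A Q]
    [AddCommGroup M] [Module A M] [AddCommGroup N] [Module A N] (p : M →ₗ[A] N) (f : Q →ₗ[A] N)
    (h : ∀ v, ∃ w, p w = f v) : ∃ g : Q →ₗ[A] M, ∀ v, p (g v) = f v := by
  obtain ⟨g, hg⟩ := Module.projective_lifting_property p.rangeRestrict
    (f.codRestrict (LinearMap.range p) h) p.surjective_rangeRestrict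
  exact ⟨g, fun v => congrArg Subtype.val (LinearMap.congr_fun hg v)⟩

theorem exists_chainMap (n t : ℕ) :
    ∃ m, ∀ (Q : ℕ → ModuleCat.{u} A) (dQ : ∀ i, Q (i + 1) →ₗ[A] Q i)
      [∀ i, Module.Projective A (Q i)], (∀ i v, dQ i (dQ (i + 1) v) = 0) →
      ∀ f₀ : Q 0 →ₗ[A] T.X 0, (∀ v, ∃ w, T.D (t + m) 0 w = f₀ (dQ 0 v)) →
      ∃ f : ∀ i, Q i →ₗ[A] T.X i, f 0 = f₀ ∧
        ∀ i < n, ∀ v, T.D t i (f (i + 1) v) = f i (dQ i v) := by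
  induction n generalizing t with
  | zero =>
    exact ⟨0, fun Q dQ _ _ f₀ _ => ⟨fun i => match i with | 0 => f₀ | _ + 1 => 0, rfl, by simp⟩⟩
  | succ n ih =>
    obtain ⟨m₁, hm₁⟩ := T.pro t
    obtain ⟨m₂, hm₂⟩ := ih (t + m₁)
    refine ⟨m₁ + m₂, fun Q dQ _ hQ f₀ hf₀ => ?_⟩
    obtain ⟨f, hf0, hf⟩ := hm₂ Q dQ hQ f₀ (by simpa [add_assoc] using hf₀)
    have key : ∀ v, ∃ w, T.D t n w = (T.Φ m₁ n ∘ₗ f n ∘ₗ dQ n) v := by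
      intro v
      cases n with
      | zero =>
        obtain ⟨w, hw⟩ := hf₀ v
        refine ⟨T.Φ (m₁ + m₂) 1 w, ?_⟩
        rw [T.D_Φ, hw, T.Φ_deg_zero]
        simp [T.Φ_deg_zero, hf0]
      | succ k =>
        obtain ⟨w, hw⟩ := hm₁ k (f (k + 1) (dQ (k + 1) v)) (by
          rw [hf k (Nat.lt_succ_self k), hQ, map_zero])
        exact ⟨w, hw⟩
    obtain ⟨g, hg⟩ := exists_lift _ _ key
    refine ⟨Function.update (fun i => T.Φ m₁ i ∘ₗ f i) (n + 1) g, ?_, ?_⟩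
    · rw [Function.update_of_ne (by omega)]
      ext v
      simp [T.Φ_deg_zero, hf0]
    · intro i hi v
      rw [Function.update_of_ne (a := i) (by omega)]
      obtain hlt | rfl := Nat.lt_succ_iff_lt_or_eq.1 hi
      · rw [Function.update_of_ne (by omega)]
        simp only [LinearMap.comp_apply]
        rw [T.D_Φ, hf i hlt]
      · rw [Function.update_self]
        exact hg v

theorem exists_homotopy (n t : ℕ) :
    ∃ m, ∀ (Q : ℕ → ModuleCat.{u} A) (dQ : ∀ i, Q (i + 1) →ₗ[A] Q i)
      [∀ i, Module.Projective A (Q i)], (∀ i v, dQ i (dQ (i + 1) v) = 0) →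
      ∀ f : ∀ i, Q i →ₗ[A] T.X i,
      (∀ i < n + 1, ∀ v, T.D (t + m) i (f (i + 1) v) = f i (dQ i v)) →
      (∀ v, ∃ w, T.D (t + m) 0 w = f 0 v) →
      ∃ h : Q n →ₗ[A] T.X (n + 1), ∀ v,
        T.D t n (h (dQ n v)) = T.D t n (T.Φ m (n + 1) (f (n + 1) v)) := by
  induction n generalizing t with
  | zero =>
    refine ⟨0, fun Q dQ _ hQ f hf hf₀ => ?_⟩
    obtain ⟨h, hh⟩ := exists_lift _ _ hf₀
    refine ⟨h, fun v => ?_⟩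
    rw [T.Φ_zero]
    exact (hh _).trans (hf 0 (by omega) v).symm
  | succ n ih =>
    obtain ⟨m₁, hm₁⟩ := T.pro t
    obtain ⟨m₂, hm₂⟩ := ih (t + m₁)
    refine ⟨m₁ + m₂, fun Q dQ _ hQ f hf hf₀ => ?_⟩
    rw [← add_assoc] at hf hf₀
    obtain ⟨h, hh⟩ := hm₂ Q dQ hQ f (fun i hi => hf i (by omega)) hf₀
    obtain ⟨h', hh'⟩ := exists_lift (T.D t (n + 1))
      (T.Φ m₁ (n + 1) ∘ₗ (T.Φ m₂ (n + 1) ∘ₗ f (n + 1) - h ∘ₗ dQ n)) (by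
        intro v
        exact hm₁ n _ (by simp [map_sub, hh]))
    refine ⟨h', fun v => ?_⟩
    rw [hh', T.D_Φ, ← add_assoc, hf (n + 1) (by omega)]
    simp [hQ, T.Φ_add]

theorem exists_isCob_comp (n t : ℕ) :
    ∃ m, ∀ (Q : ℕ → ModuleCat.{u} A) (dQ : ∀ i, Q (i + 1) →ₗ[A] Q i)
      [∀ i, Module.Projective A (Q i)], (∀ i v, dQ i (dQ (i + 1) v) = 0) →
      ∀ f : ∀ i, Q i →ₗ[A] T.X i,
      (∀ i < n, ∀ v, T.D (t + m) i (f (i + 1) v) = f i (dQ i v)) →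
      (∀ v, ∃ w, T.D (t + m) 0 w = f 0 v) →
      ∀ g : T.X n →ₗ[A] A, (∀ v, g (T.D t n v) = 0) → IsCob dQ n (g ∘ₗ T.Φ m n ∘ₗ f n) := by
  cases n with
  | zero =>
    refine ⟨0, fun Q dQ _ hQ f hf hf₀ g hg => ?_⟩
    change _ = 0
    ext v
    obtain ⟨w, hw⟩ := hf₀ v
    simp [T.Φ_zero, ← hw]
    exact hg w
  | succ n =>
    obtain ⟨m₁, hm₁⟩ := T.pro t
    obtain ⟨m₂, hm₂⟩ := T.exists_homotopy n (t + m₁)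
    refine ⟨m₁ + m₂, fun Q dQ _ hQ f hf hf₀ g hg => ?_⟩
    rw [← add_assoc] at hf hf₀
    obtain ⟨h, hh⟩ := hm₂ Q dQ hQ f hf hf₀
    refine ⟨g ∘ₗ T.Φ m₁ (n + 1) ∘ₗ h, ?_⟩
    ext v
    obtain ⟨w, hw⟩ := hm₁ n (T.Φ m₂ (n + 1) (f (n + 1) v) - h (dQ n v)) (by
      simp [map_sub, hh])
    have := hg w
    rw [hw] at this
    simp only [map_sub, sub_eq_zero] at this
    simpa [T.Φ_add] using this

end ProExactTower

/-- The features of the Koszul tower of `n` elements used below: `b t` is the ideal generated by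
the `t`-th powers and `π` is the product of the elements. -/
structure IsKoszul {A : Type u} [CommRing A] (T : ProExactTower A) (b : ℕ → Ideal A) (π : A)
    (n : ℕ) (aug : T.X 0 →ₗ[A] A) (top : T.X n →ₗ[A] A) : Prop where
  aug_bij : Function.Bijective aug
  mem_iff : ∀ t ρ, ρ ∈ b t ↔ ∃ w, aug (T.D t 0 w) = ρ
  top_bij : Function.Bijective top
  top_Φ : ∀ m v, top (T.Φ m n v) = π ^ m * top v
  subsingleton : ∀ i, n < i → Subsingleton (T.X i)
  isCob_iff : ∀ t ρ, ProExactTower.IsCob (T.D t) n (ρ • top) ↔ ρ ∈ b t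

namespace ProExactTower

section Cone

variable {A : Type u} [CommRing A]

/-- The terms of the mapping cone of a multiplication map. -/
def coneX (X : ℕ → ModuleCat.{u} A) : ℕ → ModuleCat.{u} A
  | 0 => X 0
  | i + 1 => ModuleCat.of A (X (i + 1) × X i)

/-- The differential of the mapping cone of multiplication by `y`. -/
def coneD {X : ℕ → ModuleCat.{u} A} (d : ∀ i, X (i + 1) →ₗ[A] X i) (y : A) :
    ∀ i, coneX X (i + 1) →ₗ[A] coneX X i
  | 0 => (d 0).coprod (y • LinearMap.id)
  | i + 1 => ((d (i + 1)).coprod (y • LinearMap.id)).prod ((-(d i)).comp (LinearMap.snd A _ _))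

/-- The maps between mapping cones given by `Φ` and `y • Φ`. -/
def coneΦ {X : ℕ → ModuleCat.{u} A} (Φ : ∀ i, X i →ₗ[A] X i) (y : A) :
    ∀ i, coneX X i →ₗ[A] coneX X i
  | 0 => Φ 0
  | i + 1 => (Φ (i + 1)).prodMap (y • Φ i)

section

variable {X : ℕ → ModuleCat.{u} A} (d : ∀ i, X (i + 1) →ₗ[A] X i) (Φ : ∀ i, X i →ₗ[A] X i) (y : A)

theorem coneD_zero_apply (a : X 1) (b : X 0) :
    coneD d y 0 ((a, b) : X 1 × X 0) = (d 0 a + y • b : X 0) := rfl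

theorem coneD_succ_apply (i : ℕ) (a : X (i + 2)) (b : X (i + 1)) :
    coneD d y (i + 1) ((a, b) : X (i + 2) × X (i + 1)) =
      ((d (i + 1) a + y • b, - d i b) : X (i + 1) × X i) := rfl

theorem coneΦ_succ_apply (i : ℕ) (a : X (i + 1)) (b : X i) :
    coneΦ Φ y (i + 1) ((a, b) : X (i + 1) × X i) =
      ((Φ (i + 1) a, y • Φ i b) : X (i + 1) × X i) := rfl

end

variable (T : ProExactTower A)

theorem mul_pow_mem_of_le [IsNoetherianRing A] (b : Ideal A) (y : A) :
    ∃ N, ∀ n r, y ^ n * r ∈ b → y ^ N * r ∈ b := by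
  let c : ℕ →o Ideal A :=
    { toFun := fun n => Submodule.comap (LinearMap.mulLeft A (y ^ n)) b
      monotone' := by
        intro i j hij r hr
        obtain ⟨k, rfl⟩ := Nat.exists_eq_add_of_le hij
        change y ^ (i + k) * r ∈ b
        rw [pow_add, mul_comm (y ^ i), mul_assoc]
        exact b.mul_mem_left _ hr }
  obtain ⟨N, hN⟩ := monotone_stabilizes_iff_noetherian.2 ‹IsNoetherianRing A› c
  refine ⟨N, fun n r hr => ?_⟩
  have h1 : r ∈ c (max N n) := c.monotone (le_max_right N n) hr
  rw [← hN _ (le_max_left N n)] at h1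
  exact h1

theorem pro_mono {t m : ℕ}
    (h : ∀ i v, T.D (t + m) i v = 0 → ∃ w, T.D t (i + 1) w = T.Φ m (i + 1) v) (k : ℕ) (i : ℕ)
    (v) (hv : T.D (t + (m + k)) i v = 0) :
    ∃ w, T.D t (i + 1) w = T.Φ (m + k) (i + 1) v := by
  rw [T.Φ_add]
  exact h i _ (by rw [T.D_Φ, add_assoc, hv, map_zero])

theorem cone_pro [IsNoetherianRing A] (aug : T.X 0 →ₗ[A] A) (haug : Function.Injective aug)
    (y : A) (t : ℕ) :
    ∃ m, ∀ i v, coneD (T.D (t + m)) (y ^ (t + m)) i v = 0 →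
      ∃ w, coneD (T.D t) (y ^ t) (i + 1) w = coneΦ (T.Φ m) (y ^ m) (i + 1) v := by
  obtain ⟨m₂, hm₂⟩ := T.pro t
  obtain ⟨m₁, hm₁⟩ := T.pro (t + m₂)
  obtain ⟨N, hN⟩ := mul_pow_mem_of_le (LinearMap.range (aug ∘ₗ T.D (t + m₂) 0)) y
  set m' := m₁ + N with hm'
  have hpro := T.pro_mono hm₁ N
  refine ⟨m₂ + m', ?_⟩
  rw [← add_assoc]
  have step1 : ∀ i (a : T.X (i + 1)) (b : T.X i),
      coneD (T.D (t + m₂ + m')) (y ^ (t + m₂ + m')) i ((a, b) : T.X (i + 1) × T.X i) = 0 →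
      ∃ w, T.D (t + m₂) i w = y ^ m' • T.Φ m' i b := by
    intro i a b h
    cases i with
    | zero =>
      rw [coneD_zero_apply] at h
      have h1 : y ^ (t + m₂ + m') * aug b ∈ LinearMap.range (aug ∘ₗ T.D (t + m₂) 0) := by
        refine ⟨- T.Φ m' 1 a, ?_⟩
        have h2 : T.D (t + m₂) 0 (T.Φ m' 1 a) = T.D (t + m₂ + m') 0 a := by
          rw [T.D_Φ, T.Φ_deg_zero]
        have h3 := congrArg aug h
        rw [map_add, map_smul] at h3
        have h4 : aug (T.D (t + m₂ + m') 0 a) + y ^ (t + m₂ + m') * aug b = 0 :=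
          h3.trans (map_zero aug)
        rw [map_neg, LinearMap.comp_apply, h2]
        linear_combination -h4
      obtain ⟨w, hw⟩ := hN _ _ h1
      refine ⟨y ^ m₁ • w, haug ?_⟩
      rw [T.Φ_deg_zero, map_smul, map_smul, map_smul]
      rw [LinearMap.comp_apply] at hw
      rw [hw, hm', pow_add, smul_eq_mul, smul_eq_mul, mul_assoc]
    | succ k =>
      rw [coneD_succ_apply] at h
      have h1 : T.D (t + m₂ + m') k b = 0 := neg_eq_zero.1 (congrArg Prod.snd h)
      obtain ⟨w, hw⟩ := hpro k b (by rw [← hm']; exact h1)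
      exact ⟨y ^ m' • w, by rw [map_smul, hw]⟩
  rintro i ⟨a, b⟩ hv
  obtain ⟨w, hw⟩ := step1 i a b hv
  have h1 : T.D (t + m₂) i (T.Φ m' (i + 1) a + y ^ (t + m₂) • w) = 0 := by
    rw [map_add, map_smul, hw, T.D_Φ, smul_smul, ← pow_add]
    cases i with
    | zero =>
      have h2 : (T.D (t + m₂ + m') 0 a + y ^ (t + m₂ + m') • b : T.X 0) = 0 := hv
      rw [← map_smul, ← map_add, h2, map_zero]
    | succ k =>
      have h2 : T.D (t + m₂ + m') (k + 1) a + y ^ (t + m₂ + m') • b = 0 := congrArg Prod.fst hv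
      rw [← map_smul, ← map_add, h2, map_zero]
  obtain ⟨w', hw'⟩ := hm₂ i _ h1
  refine ⟨((w', - (y ^ m₂ • T.Φ m₂ (i + 1) w)) : T.X (i + 2) × T.X (i + 1)), ?_⟩
  rw [coneD_succ_apply, coneΦ_succ_apply, hw', map_neg, neg_neg, map_smul, T.D_Φ, hw,
    T.Φ_add m₂ m' (i + 1) a, T.Φ_add m₂ m' i b]
  refine Prod.ext ?_ ?_
  · simp only [map_add, map_smul, smul_neg, smul_smul, pow_add, add_neg_cancel_right]
  · simp only [map_smul, smul_smul, pow_add]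

/-- The tower of mapping cones of the multiplications by `y ^ t` on level `t`. -/
def cone [IsNoetherianRing A] (aug : T.X 0 →ₗ[A] A) (haug : Function.Injective aug) (y : A) :
    ProExactTower A where
  X := coneX T.X
  D t := coneD (T.D t) (y ^ t)
  Φ m := coneΦ (T.Φ m) (y ^ m)
  Φ_zero i v := by
    cases i with
    | zero => exact T.Φ_zero 0 v
    | succ i =>
      obtain ⟨a, b⟩ := v
      rw [coneΦ_succ_apply, T.Φ_zero, T.Φ_zero, pow_zero, one_smul]
  Φ_add m n i v := by
    cases i with
    | zero => exact T.Φ_add m n 0 v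
    | succ i =>
      obtain ⟨a, b⟩ := v
      rw [coneΦ_succ_apply, coneΦ_succ_apply, coneΦ_succ_apply, T.Φ_add, T.Φ_add, map_smul,
        smul_smul, pow_add]
  Φ_deg_zero m v := T.Φ_deg_zero m v
  D_D t i v := by
    obtain ⟨a, b⟩ := v
    cases i with
    | zero =>
      rw [coneD_succ_apply, coneD_zero_apply, map_add, map_smul, T.D_D, smul_neg, zero_add,
        add_neg_cancel]
      rfl
    | succ i =>
      rw [coneD_succ_apply, coneD_succ_apply, map_add, map_smul, T.D_D, map_neg, T.D_D, smul_neg,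
        zero_add, add_neg_cancel, neg_zero, neg_zero]
      rfl
  D_Φ t m i v := by
    obtain ⟨a, b⟩ := v
    cases i with
    | zero =>
      rw [coneΦ_succ_apply, coneD_zero_apply, coneD_zero_apply, T.D_Φ, smul_smul, ← pow_add,
        ← map_smul, ← map_add]
      rfl
    | succ i =>
      rw [coneΦ_succ_apply, coneD_succ_apply, coneD_succ_apply, coneΦ_succ_apply, T.D_Φ,
        smul_smul, ← pow_add, ← map_smul, ← map_add, map_smul, T.D_Φ, map_neg, smul_neg]
  proj i := by
    cases i with
    | zero => exact T.proj 0
    | succ i =>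
      have := T.proj i
      have := T.proj (i + 1)
      exact inferInstanceAs (Module.Projective A (T.X (i + 1) × T.X i))
  pro := T.cone_pro aug haug y

theorem exists_eq_smul_top {M : Type*} [AddCommGroup M] [Module A M] {top : M →ₗ[A] A}
    (h : Function.Bijective top) (g : M →ₗ[A] A) : ∃ r : A, g = r • top := by
  obtain ⟨e, he⟩ := h.2 1
  refine ⟨g e, LinearMap.ext fun v => ?_⟩
  have : v = top v • e := h.1 (by simp [he])
  conv_lhs => rw [this]
  simp [mul_comm]

theorem isKoszul_cone [IsNoetherianRing A] {b : ℕ → Ideal A} {π : A} {n : ℕ}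
    {aug : T.X 0 →ₗ[A] A} {top : T.X n →ₗ[A] A} (h : IsKoszul T b π n aug top) (y : A) :
    IsKoszul (T.cone aug h.aug_bij.1 y) (fun t => b t ⊔ Ideal.span {y ^ t}) (π * y) (n + 1)
      (show T.X 0 →ₗ[A] A from aug)
      (show T.X (n + 1) × T.X n →ₗ[A] A from top ∘ₗ LinearMap.snd A _ _) where
  aug_bij := h.aug_bij
  mem_iff t ρ := by
    rw [Submodule.mem_sup]
    constructor
    · rintro ⟨r, hr, s, hs, rfl⟩
      obtain ⟨w, hw⟩ := (h.mem_iff t r).1 hr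
      obtain ⟨s, rfl⟩ := Ideal.mem_span_singleton'.1 hs
      obtain ⟨v, hv⟩ := h.aug_bij.2 s
      refine ⟨((w, v) : T.X 1 × T.X 0), ?_⟩
      change aug (T.D t 0 w + y ^ t • v) = _
      rw [map_add, map_smul, hw, hv, smul_eq_mul, mul_comm s]
    · rintro ⟨⟨w, v⟩, rfl⟩
      refine ⟨aug (T.D t 0 w), (h.mem_iff t _).2 ⟨w, rfl⟩, aug v * y ^ t,
        Ideal.mem_span_singleton'.2 ⟨_, rfl⟩, ?_⟩
      change _ = aug (T.D t 0 w + y ^ t • v)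
      rw [map_add, map_smul, smul_eq_mul, mul_comm (aug v)]
  top_bij := by
    have := h.subsingleton (n + 1) (Nat.lt_succ_self n)
    constructor
    · rintro ⟨a, v⟩ ⟨a', v'⟩ hv
      exact Prod.ext (Subsingleton.elim _ _) (h.top_bij.1 hv)
    · intro r
      obtain ⟨v, hv⟩ := h.top_bij.2 r
      exact ⟨((0, v) : T.X (n + 1) × T.X n), hv⟩
  top_Φ m v := by
    obtain ⟨a, v⟩ := v
    change top (y ^ m • T.Φ m n v) = (π * y) ^ m * top v
    rw [map_smul, h.top_Φ, smul_eq_mul, mul_pow]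
    ring
  subsingleton i hi := by
    cases i with
    | zero => omega
    | succ i =>
      have := h.subsingleton (i + 1) (by omega)
      have := h.subsingleton i (by omega)
      exact inferInstanceAs (Subsingleton (T.X (i + 1) × T.X i))
  isCob_iff t ρ := by
    have hsub := h.subsingleton (n + 1) (Nat.lt_succ_self n)
    rw [Submodule.mem_sup]
    constructor
    · rintro ⟨g, hg⟩
      cases n with
      | zero =>
        obtain ⟨r, hr⟩ := exists_eq_smul_top h.top_bij (show T.X 0 →ₗ[A] A from g)
        obtain ⟨v, hv⟩ := h.top_bij.2 1
        have h1 := LinearMap.congr_fun hg ((0, v) : T.X 1 × T.X 0)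
        change ρ * top v = (show T.X 0 →ₗ[A] A from g) (T.D t 0 0 + y ^ t • v) at h1
        rw [hr, map_zero, zero_add, map_smul, LinearMap.smul_apply, hv] at h1
        refine ⟨0, zero_mem _, ρ, Ideal.mem_span_singleton'.2 ⟨r, ?_⟩, zero_add _⟩
        simp at h1
        rw [h1, mul_comm]
      | succ k =>
        let g' : T.X (k + 1) × T.X k →ₗ[A] A := g
        obtain ⟨r, hr⟩ := exists_eq_smul_top h.top_bij (g' ∘ₗ LinearMap.inl A _ _)
        obtain ⟨r', hr'⟩ := exists_eq_smul_top h.top_bij ((g' ∘ₗ LinearMap.inr A _ _) ∘ₗ T.D t k)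
        obtain ⟨v, hv⟩ := h.top_bij.2 1
        have h1 := LinearMap.congr_fun hg ((0, v) : T.X (k + 2) × T.X (k + 1))
        change ρ * top v = g' (T.D t (k + 1) 0 + y ^ t • v, - T.D t k v) at h1
        have h2 : ((T.D t (k + 1) 0 + y ^ t • v, - T.D t k v) : T.X (k + 1) × T.X k) =
          y ^ t • LinearMap.inl A _ _ v - LinearMap.inr A _ _ (T.D t k v) := by
          ext <;> simp
        have h3 := LinearMap.congr_fun hr v
        have h4 := LinearMap.congr_fun hr' v
        simp only [LinearMap.comp_apply, LinearMap.smul_apply, smul_eq_mul, hv, mul_one] at h3 h4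
        rw [h2, map_sub, map_smul, h3, h4, hv, smul_eq_mul, mul_one] at h1
        refine ⟨- r', neg_mem ((h.isCob_iff t r').1 ⟨_, hr'.symm⟩), r * y ^ t,
          Ideal.mem_span_singleton'.2 ⟨r, rfl⟩, ?_⟩
        rw [h1]; ring
    · rintro ⟨r, hr, s, hs, rfl⟩
      obtain ⟨s, rfl⟩ := Ideal.mem_span_singleton'.1 hs
      have h0 := (h.isCob_iff t r).2 hr
      cases n with
      | zero =>
        change r • top = 0 at h0
        refine ⟨show T.X 0 →ₗ[A] A from s • top, LinearMap.ext ?_⟩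
        rintro ⟨a, v⟩
        have h1 := LinearMap.congr_fun h0 v
        simp only [LinearMap.smul_apply, smul_eq_mul, LinearMap.zero_apply] at h1
        change (r + s * y ^ t) * top v = s * top (T.D t 0 a + y ^ t • v)
        rw [Subsingleton.elim a 0, map_zero, zero_add, map_smul, smul_eq_mul, add_mul, h1]
        ring
      | succ k =>
        obtain ⟨g, hg⟩ := h0
        refine ⟨show T.X (k + 1) × T.X k →ₗ[A] A from (s • top).coprod (-g), LinearMap.ext ?_⟩
        rintro ⟨a, v⟩
        have h1 := LinearMap.congr_fun hg v
        simp only [LinearMap.smul_apply, smul_eq_mul, LinearMap.comp_apply] at h1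
        change (r + s * y ^ t) * top v =
          s * top (T.D t (k + 1) a + y ^ t • v) + - g (- T.D t k v)
        rw [Subsingleton.elim a 0, map_zero, zero_add, map_smul, smul_eq_mul, add_mul, h1, map_neg]
        ring

/-- The module `A` in degree zero. -/
def unitX (A : Type u) [CommRing A] : ℕ → ModuleCat.{u} A
  | 0 => ModuleCat.of A A
  | _ + 1 => ModuleCat.of A PUnit.{u + 1}

/-- The tower with `A` in degree zero. -/
def unit (A : Type u) [CommRing A] : ProExactTower A where
  X := unitX A
  D _ _ := 0
  Φ _ _ := LinearMap.id
  Φ_zero _ _ := rfl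
  Φ_add _ _ _ _ := rfl
  Φ_deg_zero _ _ := rfl
  D_D _ _ _ := rfl
  D_Φ _ _ _ _ := rfl
  proj i := by
    cases i with
    | zero => exact inferInstanceAs (Module.Projective A A)
    | succ i => exact inferInstanceAs (Module.Projective A PUnit.{u + 1})
  pro _ := ⟨0, fun _ _ _ => ⟨0, rfl⟩⟩

theorem isKoszul_unit : IsKoszul (unit A) (fun _ => ⊥) 1 0
    (show A →ₗ[A] A from LinearMap.id) (show A →ₗ[A] A from LinearMap.id) where
  aug_bij := Function.bijective_id
  mem_iff t ρ := by
    constructor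
    · intro h
      rw [Ideal.mem_bot] at h
      exact ⟨0, h.symm⟩
    · rintro ⟨w, rfl⟩
      exact Ideal.mem_bot.2 rfl
  top_bij := Function.bijective_id
  top_Φ m v := by rw [one_pow, one_mul]; rfl
  subsingleton i hi := match i with
    | _ + 1 => inferInstanceAs (Subsingleton PUnit.{u + 1})
  isCob_iff t ρ := by
    constructor
    · intro h
      have h1 := LinearMap.congr_fun (show ρ • (LinearMap.id : A →ₗ[A] A) = 0 from h) 1
      simpa using h1
    · intro h
      rw [Ideal.mem_bot] at h
      subst h
      exact zero_smul _ _

theorem exists_isKoszul [IsNoetherianRing A] {c : ℕ} (x : Fin c → A) :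
    ∃ (T : ProExactTower A) (aug : T.X 0 →ₗ[A] A) (top : T.X c →ₗ[A] A),
      IsKoszul T (fun t => Ideal.span (Set.range fun i => x i ^ t)) (∏ i, x i) c aug top := by
  induction c with
  | zero => exact ⟨unit A, _, _, by simpa using isKoszul_unit (A := A)⟩
  | succ c ih =>
    obtain ⟨T, aug, top, h⟩ := ih (fun i => x i.castSucc)
    have hb : (fun t => Ideal.span (Set.range fun i => x i ^ t)) = fun t =>
        Ideal.span (Set.range fun i : Fin c => x i.castSucc ^ t) ⊔
          Ideal.span {x (Fin.last c) ^ t} := by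
      funext t
      rw [← Ideal.span_union]
      congr 1
      ext z
      simp [Fin.exists_fin_succ', or_comm, eq_comm]
    rw [hb, Fin.prod_univ_castSucc]
    exact ⟨_, _, _, isKoszul_cone T h (x (Fin.last c))⟩

end Cone

end ProExactTower

section OpHomology

variable {A : Type u} [CommRing A]

/-- `z` is a cocycle representing the class `h` in the homology of a complex in the opposite
category of modules. -/
def IsClassOf (C : ChainComplex (ModuleCat.{u} A)ᵒᵖ ℕ) (n : ℕ) (z : (C.X n).unop)
    (h : (C.homology n).unop) : Prop :=
  ∃ w : (C.opcycles n).unop, (C.pOpcycles n).unop w = z ∧ (C.homologyι n).unop w = h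

namespace IsClassOf

variable {C C' : ChainComplex (ModuleCat.{u} A)ᵒᵖ ℕ} {n : ℕ}

theorem smul {z : (C.X n).unop} {h : (C.homology n).unop} (hz : IsClassOf C n z h) (a : A) :
    IsClassOf C n (a • z) (a • h) := by
  obtain ⟨w, rfl, rfl⟩ := hz
  exact ⟨a • w, map_smul _ _ _, map_smul _ _ _⟩

theorem map {z : (C'.X n).unop} {h : (C'.homology n).unop} (hz : IsClassOf C' n z h)
    (φ : C ⟶ C') :
    IsClassOf C n ((φ.f n).unop z) ((HomologicalComplex.homologyMap φ n).unop h) := by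
  obtain ⟨w, rfl, rfl⟩ := hz
  refine ⟨(HomologicalComplex.opcyclesMap φ n).unop w, ?_, ?_⟩
  · rw [← ModuleCat.comp_apply, ← ModuleCat.comp_apply, ← unop_comp, ← unop_comp,
      HomologicalComplex.p_opcyclesMap]
  · rw [← ModuleCat.comp_apply, ← ModuleCat.comp_apply, ← unop_comp, ← unop_comp,
      HomologicalComplex.homologyι_naturality]

theorem exists_rep (h : (C.homology n).unop) : ∃ z, IsClassOf C n z h := by
  have : Function.Surjective (C.homologyι n).unop :=
    (ModuleCat.epi_iff_surjective _).1 inferInstance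
  obtain ⟨w, hw⟩ := this h
  exact ⟨_, w, rfl, hw⟩

theorem p_injective : Function.Injective (C.pOpcycles n).unop :=
  (ModuleCat.mono_iff_injective _).1 inferInstance

theorem d_apply {z : (C.X n).unop} {h : (C.homology n).unop} (hz : IsClassOf C n z h) (i : ℕ) :
    (C.d i n).unop z = 0 := by
  obtain ⟨w, rfl, rfl⟩ := hz
  rw [← ModuleCat.comp_apply, ← unop_comp, HomologicalComplex.d_pOpcycles]
  rfl

theorem exists_class (z : (C.X n).unop) (hz : (C.d (n + 1) n).unop z = 0) :
    ∃ h, IsClassOf C n z h := by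
  have hex := (ShortComplex.exact_of_g_is_cokernel
    (ShortComplex.mk _ _ (C.d_pOpcycles (n + 1) n))
    (C.opcyclesIsCokernel (n + 1) n (by simp))).unop
  rw [ShortComplex.moduleCat_exact_iff] at hex
  obtain ⟨w, hw⟩ := hex z hz
  exact ⟨_, w, hw, rfl⟩

theorem zero_iff {z : (C.X n).unop} {j : ℕ} (hj : (ComplexShape.down ℕ).next n = j) :
    IsClassOf C n z 0 ↔ ∃ y, (C.d n j).unop y = z := by
  have hex := (ShortComplex.exact_of_f_is_kernel
    (ShortComplex.mk _ _ (C.homologyι_comp_fromOpcycles n j))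
    (C.homologyIsKernel n j hj)).unop
  rw [ShortComplex.moduleCat_exact_iff] at hex
  constructor
  · rintro ⟨w, rfl, hw⟩
    obtain ⟨y, hy⟩ : ∃ y : (C.X j).unop, (C.fromOpcycles n j).unop y = w := hex w hw
    refine ⟨y, ?_⟩
    have h1 : (C.d n j).unop y = (C.pOpcycles n).unop ((C.fromOpcycles n j).unop y) := by
      rw [← ModuleCat.comp_apply, ← unop_comp, C.p_fromOpcycles]
    rw [h1, hy]
  · rintro ⟨y, rfl⟩
    refine ⟨(C.fromOpcycles n j).unop y, ?_, ?_⟩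
    · rw [← ModuleCat.comp_apply, ← unop_comp, C.p_fromOpcycles]
    · rw [← ModuleCat.comp_apply, ← unop_comp, C.homologyι_comp_fromOpcycles]
      rfl

end IsClassOf

end OpHomology

section ExtClass

variable {A : Type u} [CommRing A]

/-- The complex of homomorphisms from a projective resolution to `Y`, in the opposite category. -/
noncomputable abbrev homComplex {M : ModuleCat.{u} A} (P : ProjectiveResolution M)
    (Y : ModuleCat.{u} A) : ChainComplex (ModuleCat.{u} A)ᵒᵖ ℕ :=
  (((linearYoneda A (ModuleCat.{u} A)).obj Y).rightOp.mapHomologicalComplex _).obj P.complex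

/-- `Ext` is the homology of the complex of homomorphisms from a projective resolution. -/
noncomputable def extHomologyIso {M : ModuleCat.{u} A} (P : ProjectiveResolution M)
    (Y : ModuleCat.{u} A) (n : ℕ) :
    ((Ext A (ModuleCat.{u} A) n).obj (Opposite.op M)).obj Y ≅
      ((homComplex P Y).homology n).unop :=
  (P.isoLeftDerivedObj ((linearYoneda A (ModuleCat.{u} A)).obj Y).rightOp n).symm.unop

/-- A homomorphism from a term of a projective resolution, as an element of `homComplex`. -/
def toHomComplex {M : ModuleCat.{u} A} {P : ProjectiveResolution M} {Y : ModuleCat.{u} A} {n : ℕ}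
    (f : P.complex.X n ⟶ Y) : ((homComplex P Y).X n).unop := f

/-- The `n`-cocycle `f` represents the class `h` in `Ext`. -/
def IsExtClass {M : ModuleCat.{u} A} (P : ProjectiveResolution M) {Y : ModuleCat.{u} A} (n : ℕ)
    (f : P.complex.X n ⟶ Y) (h : ((Ext A (ModuleCat.{u} A) n).obj (Opposite.op M)).obj Y) : Prop :=
  IsClassOf (homComplex P Y) n (toHomComplex f) ((extHomologyIso P Y n).hom h)

namespace IsExtClass

variable {M N : ModuleCat.{u} A} {P : ProjectiveResolution M} {Q : ProjectiveResolution N}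
  {Y : ModuleCat.{u} A} {n : ℕ}

theorem smul {f : P.complex.X n ⟶ Y} {h} (hf : IsExtClass P n f h) (a : A) :
    IsExtClass P n (a • f) (a • h) := by
  have h1 := IsClassOf.smul hf a
  have h2 := map_smul (extHomologyIso P Y n).hom.hom a h
  unfold IsExtClass
  exact h2 ▸ h1

theorem exists_rep (P : ProjectiveResolution M)
    (h : ((Ext A (ModuleCat.{u} A) n).obj (Opposite.op M)).obj Y) :
    ∃ f, IsExtClass P n f h :=
  IsClassOf.exists_rep (C := homComplex P Y) ((extHomologyIso P Y n).hom h)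

theorem d_comp {f : P.complex.X n ⟶ Y} {h} (hf : IsExtClass P n f h) :
    P.complex.d (n + 1) n ≫ f = 0 :=
  IsClassOf.d_apply hf (n + 1)

theorem exists_class (f : P.complex.X n ⟶ Y) (hf : P.complex.d (n + 1) n ≫ f = 0) :
    ∃ h, IsExtClass P n f h := by
  obtain ⟨h, hh⟩ := IsClassOf.exists_class (C := homComplex P Y) (n := n) (toHomComplex f) hf
  refine ⟨(extHomologyIso P Y n).inv h, ?_⟩
  have h1 : (extHomologyIso P Y n).hom ((extHomologyIso P Y n).inv h) = h := by simp
  unfold IsExtClass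
  rw [h1]
  exact hh

theorem zero_iff {f : P.complex.X n ⟶ Y} :
    IsExtClass P n f 0 ↔ ∃ g, P.complex.d n ((ComplexShape.down ℕ).next n) ≫ g = f := by
  unfold IsExtClass
  have h1 : (extHomologyIso P Y n).hom 0 = 0 := map_zero _
  rw [h1]
  exact IsClassOf.zero_iff (C := homComplex P Y) rfl

theorem eq_zero {f : P.complex.X n ⟶ Y} {h} (hf : IsExtClass P n f h)
    (hg : ∃ g, P.complex.d n ((ComplexShape.down ℕ).next n) ≫ g = f) : h = 0 := by
  have h1 := zero_iff.2 hg
  obtain ⟨w, hw, hw'⟩ := hf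
  obtain ⟨v, hv, hv'⟩ := h1
  have : w = v := IsClassOf.p_injective (hw.trans hv.symm)
  subst this
  exact (ModuleCat.mono_iff_injective (extHomologyIso P Y n).hom).1 inferInstance
    (hw'.symm.trans hv')

theorem map {f : Q.complex.X n ⟶ Y} {h} (hf : IsExtClass Q n f h) (w : M ⟶ N)
    (φ : P.complex ⟶ Q.complex) (comm : φ.f 0 ≫ Q.π.f 0 = P.π.f 0 ≫ w) :
    IsExtClass P n (φ.f n ≫ f)
      ((((Ext A (ModuleCat.{u} A) n).map w.op).app Y) h) := by
  let ψ : homComplex P Y ⟶ homComplex Q Y :=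
    (((linearYoneda A (ModuleCat.{u} A)).obj Y).rightOp.mapHomologicalComplex _).map φ
  have h1 := IsClassOf.map hf ψ
  have h2 : ((Ext A (ModuleCat.{u} A) n).map w.op).app Y ≫ (extHomologyIso P Y n).hom =
      (extHomologyIso Q Y n).hom ≫ (HomologicalComplex.homologyMap ψ n).unop :=
    congrArg Quiver.Hom.unop (ProjectiveResolution.isoLeftDerivedObj_inv_naturality w P Q φ comm
      ((linearYoneda A (ModuleCat.{u} A)).obj Y).rightOp n)
  have h3 : (extHomologyIso P Y n).hom ((((Ext A (ModuleCat.{u} A) n).map w.op).app Y) h) =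
      (HomologicalComplex.homologyMap ψ n).unop ((extHomologyIso Q Y n).hom h) := by
    rw [← ModuleCat.comp_apply, h2, ModuleCat.comp_apply]
  unfold IsExtClass
  rw [h3]
  exact h1

end IsExtClass

end ExtClass

section LocalCohomologyColimit

open Limits Opposite

variable {A : Type u} [CommRing A] (I : Ideal A)

/-- The projection `A ⧸ I ^ s' ⟶ A ⧸ I ^ s` for `s ≤ s'`. -/
noncomputable def quotPowMap {s s' : ℕ} (h : s ≤ s') :
    ModuleCat.of A (A ⧸ I ^ s') ⟶ ModuleCat.of A (A ⧸ I ^ s) :=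
  ModuleCat.ofHom (Submodule.mapQ _ _ LinearMap.id (Ideal.pow_le_pow_right h))

/-- The map to local cohomology from `Ext`. -/
noncomputable def extToLocalCohomology (c s : ℕ) (Y : ModuleCat.{u} A) :
    ((Ext A (ModuleCat.{u} A) c).obj (op (ModuleCat.of A (A ⧸ I ^ s)))).obj Y ⟶
      (localCohomology I c).obj Y :=
  (colimit.ι (localCohomology.diagram (localCohomology.idealPowersDiagram I) c)
    (op (op s))).app Y

theorem ModuleCat.preservesColimit_forget_of_nat_op_op (F : ℕᵒᵖᵒᵖ ⥤ ModuleCat.{u} A) :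
    PreservesColimit F (forget (ModuleCat.{u} A)) := by
  have : PreservesFilteredColimitsOfSize.{0, 0} (forget (ModuleCat.{u} A)) :=
    preservesFilteredColimitsOfSize_shrink.{0, u, 0, u} _
  infer_instance

theorem extToLocalCohomology_exists_rep (c : ℕ) (Y : ModuleCat.{u} A)
    (z : (localCohomology I c).obj Y) :
    ∃ s h, extToLocalCohomology I c s Y h = z := by
  have hc := isColimitOfPreserves ((evaluation (ModuleCat.{u} A) (ModuleCat.{u} A)).obj Y)
    (colimit.isColimit (localCohomology.diagram (localCohomology.idealPowersDiagram I) c))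
  have := ModuleCat.preservesColimit_forget_of_nat_op_op
    (localCohomology.diagram (localCohomology.idealPowersDiagram I) c ⋙
      (evaluation (ModuleCat.{u} A) (ModuleCat.{u} A)).obj Y)
  obtain ⟨j, y, hy⟩ := Concrete.isColimit_exists_rep _ hc z
  exact ⟨j.unop.unop, y, hy⟩

theorem extToLocalCohomology_map (c : ℕ) (Y : ModuleCat.{u} A) {s s' : ℕ} (hs : s ≤ s') (h) :
    extToLocalCohomology I c s' Y
      ((((Ext A (ModuleCat.{u} A) c).map (quotPowMap I hs).op).app Y) h) =
      extToLocalCohomology I c s Y h := by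
  have h1 := congrArg (fun k => k.app Y h)
    (colimit.w (localCohomology.diagram (localCohomology.idealPowersDiagram I) c)
      (homOfLE hs).op.op)
  exact h1

theorem extToLocalCohomology_eq_zero (c : ℕ) (Y : ModuleCat.{u} A) {s : ℕ} {h}
    (hz : extToLocalCohomology I c s Y h = 0) :
    ∃ (s' : ℕ) (hs : s ≤ s'),
      (((Ext A (ModuleCat.{u} A) c).map (quotPowMap I hs).op).app Y) h = 0 := by
  have hc := isColimitOfPreserves ((evaluation (ModuleCat.{u} A) (ModuleCat.{u} A)).obj Y)
    (colimit.isColimit (localCohomology.diagram (localCohomology.idealPowersDiagram I) c))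
  have h0 : extToLocalCohomology I c s Y h = extToLocalCohomology I c s Y 0 := by
    rw [hz]; exact (map_zero (extToLocalCohomology I c s Y).hom).symm
  have := ModuleCat.preservesColimit_forget_of_nat_op_op
    (localCohomology.diagram (localCohomology.idealPowersDiagram I) c ⋙
      (evaluation (ModuleCat.{u} A) (ModuleCat.{u} A)).obj Y)
  obtain ⟨k, f, g, hfg⟩ := Concrete.isColimit_exists_of_rep_eq _ hc (i := op (op s))
    (j := op (op s)) h 0 h0
  refine ⟨k.unop.unop, leOfHom f.unop.unop, ?_⟩
  have h1 := hfg.trans (map_zero _)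
  exact h1

end LocalCohomologyColimit

section Resolution

variable {A : Type u} [CommRing A]

/-- A projective resolution, as a constant tower. -/
noncomputable def resTower {M : ModuleCat.{u} A} (P : ProjectiveResolution M) :
    ProExactTower A where
  X := P.complex.X
  D _ i := (P.complex.d (i + 1) i).hom
  Φ _ _ := LinearMap.id
  Φ_zero _ _ := rfl
  Φ_add _ _ _ _ := rfl
  Φ_deg_zero _ _ := rfl
  D_D _ i v := by
    have h := P.complex.d_comp_d (i + 2) (i + 1) i
    exact congrArg (fun k => k.hom v) h
  D_Φ _ _ _ _ := rfl
  proj i := (IsProjective.iff_projective (R := A) (P.complex.X i)).2 (P.projective i)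
  pro _ := ⟨0, fun i v hv => by
    have h := P.complex_exactAt_succ i
    rw [HomologicalComplex.exactAt_iff' _ (i + 2) (i + 1) i (by simp) (by simp),
      ShortComplex.moduleCat_exact_iff] at h
    exact h v hv⟩

/-- The augmentation of a projective resolution. -/
noncomputable def resAug {M : ModuleCat.{u} A} (P : ProjectiveResolution M) :
    (resTower P).X 0 →ₗ[A] M :=
  (P.π.f 0).hom

theorem resAug_surjective {M : ModuleCat.{u} A} (P : ProjectiveResolution M) :
    Function.Surjective (resAug P) :=
  (ModuleCat.epi_iff_surjective (P.π.f 0)).1 inferInstance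

theorem resAug_eq_zero_iff {M : ModuleCat.{u} A} (P : ProjectiveResolution M) (t : ℕ)
    (v : (resTower P).X 0) : resAug P v = 0 ↔ ∃ w, (resTower P).D t 0 w = v := by
  constructor
  · intro hv
    exact (ShortComplex.moduleCat_exact_iff _).1 P.exact₀ v hv
  · rintro ⟨w, rfl⟩
    exact congrArg (fun k => k.hom w) P.complex_d_comp_π_f_zero

theorem isCob_resTower_iff {M : ModuleCat.{u} A} (P : ProjectiveResolution M) (n t : ℕ)
    (f : (resTower P).X n →ₗ[A] A) :
    ProExactTower.IsCob ((resTower P).D t) n f ↔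
      ∃ g, P.complex.d n ((ComplexShape.down ℕ).next n) ≫ g =
        (ModuleCat.ofHom f : P.complex.X n ⟶ ModuleCat.of A A) := by
  cases n with
  | zero =>
    have h0 : P.complex.d 0 ((ComplexShape.down ℕ).next 0) = 0 := P.complex.shape _ _ (by simp)
    simp only [h0, Limits.zero_comp, exists_const]
    change f = 0 ↔ _
    constructor
    · rintro rfl; rfl
    · intro h
      exact (congrArg ModuleCat.Hom.hom h).symm
  | succ n =>
    rw [show (ComplexShape.down ℕ).next (n + 1) = n by simp]
    constructor
    · rintro ⟨h, rfl⟩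
      exact ⟨ModuleCat.ofHom h, rfl⟩
    · rintro ⟨g, hg⟩
      exact ⟨g.hom, (congrArg ModuleCat.Hom.hom hg).symm⟩

variable (I : Ideal A)

/-- A projective resolution of `A ⧸ I ^ s`. -/
noncomputable def powRes (s : ℕ) : ProjectiveResolution (ModuleCat.of A (A ⧸ I ^ s)) :=
  projectiveResolution _

/-- A lift of the projection to resolutions. -/
noncomputable def powResMap {s s' : ℕ} (h : s ≤ s') (i : ℕ) :
    (resTower (powRes I s')).X i →ₗ[A] (resTower (powRes I s)).X i :=
  ((ProjectiveResolution.lift (quotPowMap I h) (powRes I s') (powRes I s)).f i).hom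

theorem powResMap_d {s s' : ℕ} (h : s ≤ s') (t t' i : ℕ) (v) :
    (resTower (powRes I s)).D t i (powResMap I h (i + 1) v) =
      powResMap I h i ((resTower (powRes I s')).D t' i v) :=
  congrArg (fun k => k.hom v)
    ((ProjectiveResolution.lift (quotPowMap I h) (powRes I s') (powRes I s)).comm (i + 1) i)

theorem resAug_powResMap {s s' : ℕ} (h : s ≤ s') (v) (a : A)
    (ha : resAug (powRes I s') v = Ideal.Quotient.mk (I ^ s') a) :
    resAug (powRes I s) (powResMap I h 0 v) = Ideal.Quotient.mk (I ^ s) a := by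
  have h1 := congrArg (fun k => k.hom v)
    (ProjectiveResolution.lift_commutes_zero (quotPowMap I h) (powRes I s') (powRes I s))
  refine h1.trans ?_
  change (quotPowMap I h).hom (resAug (powRes I s') v) = _
  rw [ha]
  rfl

/-- The cocycle `f` represents the local cohomology class `z`. -/
def Represents (c s : ℕ) (f : (resTower (powRes I s)).X c →ₗ[A] A)
    (z : (localCohomology I c).obj (ModuleCat.of A A)) : Prop :=
  ∃ h, IsExtClass (powRes I s) c (ModuleCat.ofHom f) h ∧
    extToLocalCohomology I c s (ModuleCat.of A A) h = z

namespace Represents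

variable {I} {c s : ℕ} {f : (resTower (powRes I s)).X c →ₗ[A] A}
  {z : (localCohomology I c).obj (ModuleCat.of A A)}

theorem exists_rep (z : (localCohomology I c).obj (ModuleCat.of A A)) :
    ∃ s f, Represents I c s f z := by
  obtain ⟨s, h, rfl⟩ := extToLocalCohomology_exists_rep I c (ModuleCat.of A A) z
  obtain ⟨f, hf⟩ := IsExtClass.exists_rep (powRes I s) h
  exact ⟨s, f.hom, h, hf, rfl⟩

theorem exists_class (t : ℕ) (hf : ∀ v, f ((resTower (powRes I s)).D t c v) = 0) :
    ∃ z, Represents I c s f z := by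
  obtain ⟨h, hh⟩ := IsExtClass.exists_class (P := powRes I s) (Y := ModuleCat.of A A)
    (n := c) (ModuleCat.ofHom f) (by ext v; exact hf v)
  exact ⟨_, h, hh, rfl⟩

theorem apply_d (h : Represents I c s f z) (t : ℕ) (v) :
    f ((resTower (powRes I s)).D t c v) = 0 := by
  obtain ⟨h, hh, -⟩ := h
  exact congrArg (fun k => k.hom v) hh.d_comp

theorem smul (h : Represents I c s f z) (a : A) : Represents I c s (a • f) (a • z) := by
  obtain ⟨h, hh, rfl⟩ := h
  exact ⟨a • h, hh.smul a, map_smul _ _ _⟩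

theorem comp_powResMap (h : Represents I c s f z) {s' : ℕ} (hs : s ≤ s') :
    Represents I c s' (f ∘ₗ powResMap I hs c) z := by
  obtain ⟨h, hh, rfl⟩ := h
  exact ⟨_, hh.map (quotPowMap I hs)
    (ProjectiveResolution.lift (quotPowMap I hs) (powRes I s') (powRes I s))
    (ProjectiveResolution.lift_commutes_zero _ _ _), extToLocalCohomology_map I c _ hs h⟩

theorem eq_zero (h : Represents I c s f z) (t : ℕ)
    (hf : ProExactTower.IsCob ((resTower (powRes I s)).D t) c f) : z = 0 := by
  obtain ⟨h, hh, rfl⟩ := h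
  rw [hh.eq_zero ((isCob_resTower_iff _ _ _ _).1 hf)]
  exact map_zero (extToLocalCohomology I c s _).hom

theorem exists_isCob (h : Represents I c s f 0) (t : ℕ) :
    ∃ (s' : ℕ) (hs : s ≤ s'),
      ProExactTower.IsCob ((resTower (powRes I s')).D t) c (f ∘ₗ powResMap I hs c) := by
  obtain ⟨h, hh, h0⟩ := h
  obtain ⟨s', hs, h1⟩ := extToLocalCohomology_eq_zero I c _ h0
  refine ⟨s', hs, (isCob_resTower_iff _ _ _ _).2 (IsExtClass.zero_iff.1 ?_)⟩
  have := hh.map (quotPowMap I hs)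
    (ProjectiveResolution.lift (quotPowMap I hs) (powRes I s') (powRes I s))
    (ProjectiveResolution.lift_commutes_zero _ _ _)
  rw [h1] at this
  exact this

end Represents

end Resolution

theorem exists_linearMap_fractionless_ne_zero {C M : Type*} [CommRing C] [IsDomain C]
    [AddCommGroup M] [Module C M] [Module.Finite C M] (a : M)
    (ha : ∀ f : C, f ≠ 0 → f • a ≠ 0) : ∃ h : M →ₗ[C] C, h a ≠ 0 := by
  let K := FractionRing C
  let V := LocalizedModule (nonZeroDivisors C) M
  let ι : M →ₗ[C] V := LocalizedModule.mkLinearMap (nonZeroDivisors C) M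
  let _ : Module K V := inferInstanceAs (Module (Localization (nonZeroDivisors C)) V)
  have : IsScalarTower C K V :=
    inferInstanceAs (IsScalarTower C (Localization (nonZeroDivisors C)) V)
  have hι : ι a ≠ 0 := by
    intro h0
    rw [IsLocalizedModule.eq_zero_iff (nonZeroDivisors C)] at h0
    obtain ⟨s, hs⟩ := h0
    exact ha s (nonZeroDivisors.coe_ne_zero s) hs
  obtain ⟨g, hg⟩ : ∃ g : V →ₗ[K] K, g (ι a) ≠ 0 := by
    by_contra! hcon
    exact hι ((Module.forall_dual_apply_eq_zero_iff K _).1 hcon)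
  let g' : M →ₗ[C] K := (g.restrictScalars C) ∘ₗ ι
  obtain ⟨s, hs⟩ := (Module.Finite.fg_top : (⊤ : Submodule C M).FG)
  classical
  obtain ⟨b, hb⟩ := IsLocalization.exist_integer_multiples_of_finset (nonZeroDivisors C)
    (s.image g')
  have hr : ∀ m : M, ((b : C) • g') m ∈ LinearMap.range (Algebra.linearMap C K) := by
    intro m
    have hm : m ∈ Submodule.span C (s : Set M) := by rw [hs]; trivial
    induction hm using Submodule.span_induction with
    | mem x hx =>
      obtain ⟨z, hz⟩ := hb (g' x) (Finset.mem_image_of_mem _ hx)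
      exact ⟨z, hz⟩
    | zero => simp
    | add x y _ _ hx hy => rw [map_add]; exact add_mem hx hy
    | smul r x _ hx => rw [map_smul]; exact Submodule.smul_mem _ _ hx
  have hinj : Function.Injective (Algebra.linearMap C K) := IsFractionRing.injective C K
  let e := LinearEquiv.ofInjective (Algebra.linearMap C K) hinj
  refine ⟨e.symm.toLinearMap ∘ₗ ((b : C) • g').codRestrict _ hr, ?_⟩
  intro h0
  have h1 : ((b : C) • g').codRestrict _ hr a = 0 := by
    simpa using h0
  have h2 : (b : C) • g (ι a) = 0 := congrArg Subtype.val h1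
  rw [Algebra.smul_def, mul_eq_zero] at h2
  rcases h2 with h2 | h2
  · exact nonZeroDivisors.coe_ne_zero b (hinj (h2.trans (map_zero _).symm))
  · exact hg h2

theorem exists_linearMap_quotient_prime_ne_zero {S T : Type*} [CommRing S] [CommRing T]
    [Algebra S T] [Module.Finite S T] (P : Ideal S) [P.IsPrime] (a : T)
    (ha : ∀ f : S, f ∉ P → f • a ∉ P.map (algebraMap S T)) :
    ∃ h : T →ₗ[S] (S ⧸ P), h a ≠ 0 := by
  have hmem : ∀ z : T, z ∈ P • (⊤ : Submodule S T) → z ∈ P.map (algebraMap S T) := by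
    intro z hz
    rw [Ideal.smul_top_eq_map] at hz
    exact hz
  let M := T ⧸ (P • (⊤ : Submodule S T))
  have : Module.Finite (S ⧸ P) M := Module.Finite.of_restrictScalars_finite S _ _
  obtain ⟨h, hh⟩ := exists_linearMap_fractionless_ne_zero (C := S ⧸ P) (M := M)
    (Submodule.Quotient.mk a) (by
      intro f hf
      obtain ⟨f, rfl⟩ := Ideal.Quotient.mk_surjective f
      intro h0
      refine ha f (fun hfP => hf (Ideal.Quotient.eq_zero_iff_mem.2 hfP)) (hmem _ ?_)
      exact (Submodule.Quotient.mk_eq_zero _).1 h0)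
  exact ⟨(h.restrictScalars S) ∘ₗ Submodule.mkQ _, hh⟩

theorem RingHom.Finite.exists_addMonoidHom_quotient_prime {S T : Type*} [CommRing S] [CommRing T]
    {φ : S →+* T} (hφ : φ.Finite) (P : Ideal S) [P.IsPrime] (a : T)
    (ha : ∀ f : S, f ∉ P → φ f * a ∉ P.map φ) :
    ∃ h : T →+ S ⧸ P, (∀ r z, h (φ r * z) = Ideal.Quotient.mk P r * h z) ∧ h a ≠ 0 := by
  algebraize [φ]
  obtain ⟨h, hh⟩ := exists_linearMap_quotient_prime_ne_zero P a (fun f hf => by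
    rw [Algebra.smul_def]; exact ha f hf)
  refine ⟨h.toAddMonoidHom, fun r z => ?_, hh⟩
  have := h.map_smul r z
  rw [Algebra.smul_def, Algebra.smul_def] at this
  exact this

/-- The elements `u` of `S` such that `u * (∏ x i) ^ k` lies in `(x i ^ (k + t))` for some `k`;
this is the annihilator of the class `[1 / ∏ x i ^ t]` in the top Čech cohomology module. -/
def limColon {S : Type*} [CommRing S] {c : ℕ} (x : Fin c → S) (t : ℕ) : Set S :=
  {u | ∃ k, u * (∏ i, x i) ^ k ∈ Ideal.span (Set.range fun i => x i ^ (k + t))}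

section limColon

variable {S : Type*} [CommRing S] {c : ℕ} (x : Fin c → S)

theorem mul_prod_pow_add_mem_span {u : S} {k t : ℕ}
    (h : u * (∏ i, x i) ^ k ∈ Ideal.span (Set.range fun i => x i ^ (k + t))) (j : ℕ) :
    u * (∏ i, x i) ^ (k + j) ∈ Ideal.span (Set.range fun i => x i ^ (k + j + t)) := by
  rw [Ideal.mem_span_range_iff_exists_fun] at h
  obtain ⟨r, hr⟩ := h
  rw [pow_add, ← mul_assoc, ← hr, Finset.sum_mul]
  refine Ideal.sum_mem _ fun i _ => ?_
  have h1 : (∏ i, x i) ^ j = (∏ i' ∈ Finset.univ.erase i, x i') ^ j * x i ^ j := by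
    rw [← mul_pow, mul_comm, Finset.mul_prod_erase _ _ (Finset.mem_univ i)]
  have h2 : r i * x i ^ (k + t) * (∏ i, x i) ^ j =
      (r i * (∏ i' ∈ Finset.univ.erase i, x i') ^ j) * x i ^ (k + j + t) := by
    rw [h1]; ring
  rw [h2]
  exact Ideal.mul_mem_left _ _ (Ideal.subset_span ⟨i, rfl⟩)

theorem limColon_enlarge {u : S} {k K t : ℕ} (hk : k ≤ K)
    (h : u * (∏ i, x i) ^ k ∈ Ideal.span (Set.range fun i => x i ^ (k + t))) :
    u * (∏ i, x i) ^ K ∈ Ideal.span (Set.range fun i => x i ^ (K + t)) := by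
  obtain ⟨j, rfl⟩ := Nat.exists_eq_add_of_le hk
  exact mul_prod_pow_add_mem_span x h j

/-- `limColon x t` as an ideal. -/
def limColonIdeal (t : ℕ) : Ideal S where
  carrier := limColon x t
  zero_mem' := ⟨0, by simp⟩
  add_mem' := by
    rintro u v ⟨k, hk⟩ ⟨l, hl⟩
    refine ⟨max k l, ?_⟩
    rw [add_mul]
    exact add_mem (limColon_enlarge x (le_max_left _ _) hk)
      (limColon_enlarge x (le_max_right _ _) hl)
  smul_mem' := by
    rintro r u ⟨k, hk⟩
    refine ⟨k, ?_⟩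
    rw [smul_eq_mul, mul_assoc]
    exact Ideal.mul_mem_left _ _ hk

theorem mem_limColonIdeal_of_add {t k : ℕ} {u : S}
    (h : u * (∏ i, x i) ^ k ∈
      Ideal.span (Set.range fun i => x i ^ (k + t)) ⊔ limColonIdeal x (k + t)) :
    u ∈ limColonIdeal x t := by
  obtain ⟨y, hy, z, ⟨l, hl⟩, hyz⟩ := Submodule.mem_sup.1 h
  refine ⟨k + l, ?_⟩
  rw [pow_add, ← mul_assoc, ← hyz, add_mul]
  refine add_mem ?_ ?_
  · rw [Ideal.mem_span_range_iff_exists_fun] at hy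
    obtain ⟨r, rfl⟩ := hy
    rw [Finset.sum_mul]
    refine Ideal.sum_mem _ fun i _ => ?_
    have h1 : (∏ i, x i) ^ l = (∏ i' ∈ Finset.univ.erase i, x i') ^ l * x i ^ l := by
      rw [← mul_pow, mul_comm, Finset.mul_prod_erase _ _ (Finset.mem_univ i)]
    have h2 : r i * x i ^ (k + t) * (∏ i, x i) ^ l =
        (r i * (∏ i' ∈ Finset.univ.erase i, x i') ^ l) * x i ^ (k + l + t) := by
      rw [h1]; ring
    rw [h2]
    exact Ideal.mul_mem_left _ _ (Ideal.subset_span ⟨i, rfl⟩)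
  · have h3 : l + (k + t) = k + l + t := by ring
    rwa [h3] at hl

end limColon

theorem one_mem_limColon_of_forall_mem_of_frobenius_finite {S : Type*} [CommRing S]
    [IsNoetherianRing S] (p : ℕ) [hp : Fact p.Prime] [CharP S p]
    (hF : (frobenius S p).Finite) {c : ℕ} (x : Fin c → S) (a : S)
    (hreg : ∀ s : S, s * a = 0 → s = 0) (ha : ∀ t, a ∈ limColon x t) (t : ℕ) :
    (1 : S) ∈ limColon x t := by
  classical
  by_contra h1
  let J : Ideal S := ⨅ t, limColonIdeal x t
  have hJmem : ∀ {u : S}, u ∈ J ↔ ∀ t, u ∈ limColon x t := fun {u} => Submodule.mem_iInf _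
  have hJ : (1 : S) ∉ J := fun h => h1 (hJmem.1 h t)
  have hne : (Submodule.Quotient.mk (1 : S) : S ⧸ J) ≠ 0 := fun h =>
    hJ ((Submodule.Quotient.mk_eq_zero J).1 h)
  obtain ⟨P, hP, -⟩ := exists_le_isAssociatedPrime_of_isNoetherianRing S _ hne
  rw [isAssociatedPrime_iff] at hP
  obtain ⟨hPprime, w, hw⟩ := hP
  obtain ⟨s, rfl⟩ := Submodule.Quotient.mk_surjective _ w
  have hPmem : ∀ v : S, v ∈ P ↔ v * s ∈ J := by
    intro v
    rw [hw, Submodule.mem_colon_singleton, Submodule.mem_bot, ← Submodule.Quotient.mk_smul,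
      Submodule.Quotient.mk_eq_zero, smul_eq_mul]
  obtain ⟨e, he⟩ : ∃ e : ℕ, ∀ f : S, f ∉ P →
      iterateFrobenius S p e f * a ∉ P.map (iterateFrobenius S p e) := by
    by_contra! hcon
    have hle : ∀ e, P.map (iterateFrobenius S p e) ≤ P ^ (p ^ e) := by
      intro e
      rw [Ideal.map_le_iff_le_comap]
      intro z hz
      rw [Ideal.mem_comap, iterateFrobenius_def]
      exact Ideal.pow_mem_pow hz _
    let R := Localization.AtPrime P
    have h0 : algebraMap S R a = 0 := by
      have hmem : algebraMap S R a ∈ ⨅ i, (IsLocalRing.maximalIdeal R) ^ i := by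
        rw [Submodule.mem_iInf]
        intro i
        obtain ⟨f, hf, hfa⟩ := hcon i
        have h2 : algebraMap S R (iterateFrobenius S p i f * a) ∈
            (IsLocalRing.maximalIdeal R) ^ (p ^ i) := by
          rw [← Localization.AtPrime.map_eq_maximalIdeal, ← Ideal.map_pow]
          exact Ideal.mem_map_of_mem _ (hle i hfa)
        rw [map_mul, iterateFrobenius_def, map_pow] at h2
        have hu : IsUnit (algebraMap S R f ^ p ^ i) :=
          (IsLocalization.map_units R (⟨f, hf⟩ : P.primeCompl)).pow _
        rw [Ideal.unit_mul_mem_iff_mem _ hu] at h2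
        exact Ideal.pow_le_pow_right (Nat.lt_pow_self hp.1.one_lt).le h2
      rw [Ideal.iInf_pow_eq_bot_of_isLocalRing _ (Ideal.IsPrime.ne_top')] at hmem
      exact hmem
    rw [IsLocalization.map_eq_zero_iff P.primeCompl] at h0
    obtain ⟨f, hf⟩ := h0
    exact f.2 (by rw [hreg _ hf]; exact P.zero_mem)
  have hfin : (iterateFrobenius S p e).Finite := by
    clear he
    induction e with
    | zero =>
      rw [iterateFrobenius_zero]; exact RingHom.Finite.id S
    | succ e ih =>
      rw [iterateFrobenius_add, iterateFrobenius_one]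
      exact ih.comp hF
  obtain ⟨h, hmul, hne⟩ := hfin.exists_addMonoidHom_quotient_prime P a he
  obtain ⟨v, hv⟩ := Ideal.Quotient.mk_surjective (h a)
  have hvP : v ∉ P := fun hv' => hne (by rw [← hv, Ideal.Quotient.eq_zero_iff_mem.2 hv'])
  refine hvP ((hPmem v).2 (hJmem.2 fun t => ?_))
  obtain ⟨k, hk⟩ := ha (p ^ e * t)
  have hk' := limColon_enlarge x (Nat.le_mul_of_pos_left k (pow_pos hp.1.pos e)) hk
  rw [← mul_add, Ideal.mem_span_range_iff_exists_fun] at hk'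
  obtain ⟨r, hr⟩ := hk'
  have h3 : Ideal.Quotient.mk P (v * (∏ i, x i) ^ k) = ∑ i, Ideal.Quotient.mk P (x i ^ (k + t)) *
      h (r i) := by
    have := congrArg h hr
    rw [map_sum] at this
    rw [map_mul, hv, mul_comm, ← hmul, iterateFrobenius_def, ← pow_mul, mul_comm k, mul_comm _ a,
      ← this]
    refine Finset.sum_congr rfl fun i _ => ?_
    rw [← hmul, iterateFrobenius_def, ← pow_mul, mul_comm (k + t), mul_comm]
  choose r' hr' using fun i => Ideal.Quotient.mk_surjective (h (r i))
  simp_rw [← hr', ← map_mul, ← map_sum] at h3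
  rw [Ideal.Quotient.eq, hPmem] at h3
  apply mem_limColonIdeal_of_add x (k := k)
  have h4 : v * s * (∏ i, x i) ^ k = (∑ i, x i ^ (k + t) * r' i) * s +
      (v * (∏ i, x i) ^ k - ∑ i, x i ^ (k + t) * r' i) * s := by ring
  rw [h4]
  refine add_mem (Ideal.mem_sup_left ?_) (Ideal.mem_sup_right (hJmem.1 h3 _))
  rw [Finset.sum_mul]
  refine Ideal.sum_mem _ fun i _ => ?_
  rw [mul_assoc]
  exact Ideal.mul_mem_right _ _ (Ideal.subset_span ⟨i, rfl⟩)

section Koszul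

variable {A : Type u} [CommRing A] {I : Ideal A} {T : ProExactTower A} {b : ℕ → Ideal A} {π : A}
  {c : ℕ} {aug : T.X 0 →ₗ[A] A} {top : T.X c →ₗ[A] A}

/-- A map from a resolution to a Koszul tower. -/
theorem IsKoszul.exists_map_of_powRes (hK : IsKoszul T b π c aug top) (n t : ℕ) :
    ∃ m, ∀ s, I ^ s ≤ b (t + m) → ∃ v : ∀ i, (resTower (powRes I s)).X i →ₗ[A] T.X i,
      (∀ w, Ideal.Quotient.mk (I ^ s) (aug (v 0 w)) = resAug (powRes I s) w) ∧
      ∀ i < n, ∀ w, T.D t i (v (i + 1) w) = v i ((resTower (powRes I s)).D 0 i w) := by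
  obtain ⟨m, hm⟩ := T.exists_chainMap n t
  refine ⟨m, fun s hs => ?_⟩
  have := (resTower (powRes I s)).proj
  obtain ⟨v₀, hv₀⟩ := ProExactTower.exists_lift
    ((Algebra.linearMap A (A ⧸ I ^ s)) ∘ₗ aug) (resAug (powRes I s)) (fun w => by
      obtain ⟨r, hr⟩ := Ideal.Quotient.mk_surjective (I := I ^ s) (resAug (powRes I s) w)
      obtain ⟨y, rfl⟩ := hK.aug_bij.2 r
      exact ⟨y, hr⟩)
  obtain ⟨v, rfl, hv⟩ := hm _ ((resTower (powRes I s)).D 0) ((resTower (powRes I s)).D_D 0) v₀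
    (fun w => by
      have h1 : aug (v₀ ((resTower (powRes I s)).D 0 0 w)) ∈ b (t + m) := by
        refine hs (Ideal.Quotient.eq_zero_iff_mem.1 ((hv₀ _).trans ?_))
        exact (resAug_eq_zero_iff _ 0 _).2 ⟨w, rfl⟩
      obtain ⟨y, hy⟩ := (hK.mem_iff _ _).1 h1
      exact ⟨y, hK.aug_bij.1 hy⟩)
  exact ⟨v, hv₀, hv⟩

/-- A map from a Koszul tower to a resolution. -/
theorem IsKoszul.exists_map_to_powRes (hK : IsKoszul T b π c aug top) (n s r : ℕ)
    (hs : b r ≤ I ^ s) : ∃ u : ∀ i, T.X i →ₗ[A] (resTower (powRes I s)).X i,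
      (∀ w, resAug (powRes I s) (u 0 w) = Ideal.Quotient.mk (I ^ s) (aug w)) ∧
      ∀ i < n, ∀ w, (resTower (powRes I s)).D 0 i (u (i + 1) w) = u i (T.D r i w) := by
  have := T.proj
  obtain ⟨m, hm⟩ := (resTower (powRes I s)).exists_chainMap n 0
  obtain ⟨u₀, hu₀⟩ := ProExactTower.exists_lift (resAug (powRes I s))
    ((Algebra.linearMap A (A ⧸ I ^ s)) ∘ₗ aug) (fun w => resAug_surjective _ _)
  obtain ⟨u, rfl, hu⟩ := hm _ (T.D r) (T.D_D r) u₀ (fun w => by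
    refine (resAug_eq_zero_iff _ _ _).1 ((hu₀ _).trans ?_)
    exact Ideal.Quotient.eq_zero_iff_mem.2 (hs ((hK.mem_iff _ _).2 ⟨w, rfl⟩)))
  exact ⟨u, hu₀, hu⟩

theorem IsKoszul.mul_pow_mem_of_forall_smul_eq_zero (hK : IsKoszul T b π c aug top)
    (hanti : Antitone b) (h₁ : ∀ t, ∃ s, I ^ s ≤ b t) (h₂ : ∀ s, ∃ r, b r ≤ I ^ s)
    {a : A} (ha : ∀ z : (localCohomology I c).obj (ModuleCat.of A A), a • z = 0) (t₀ : ℕ) :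
    ∃ k, a * π ^ k ∈ b (t₀ + k) := by
  obtain ⟨m, hm⟩ := T.exists_isCob_comp c t₀
  obtain ⟨m₁, hm₁⟩ := hK.exists_map_of_powRes (I := I) (c + 1) (t₀ + m)
  obtain ⟨s, hs⟩ := h₁ (t₀ + m + m₁)
  obtain ⟨v, hv₀, hv⟩ := hm₁ s hs
  have hsub := hK.subsingleton (c + 1) (Nat.lt_succ_self c)
  obtain ⟨z, hz⟩ := Represents.exists_class (I := I) (s := s)
    (f := top ∘ₗ T.Φ m c ∘ₗ v c) 0 (fun w => by
      simp only [LinearMap.comp_apply]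
      rw [← hv c (Nat.lt_succ_self c), Subsingleton.elim (v (c + 1) w) 0]
      simp)
  have hz' := hz.smul a
  rw [ha] at hz'
  obtain ⟨s', hs', hcob⟩ := hz'.exists_isCob 0
  obtain ⟨r, hr⟩ := h₂ s'
  obtain ⟨u, hu₀, hu⟩ := hK.exists_map_to_powRes c s' (t₀ + m + r)
    ((hanti (Nat.le_add_left _ _)).trans hr)
  have hcob₁ := hcob.comp (dQ := T.D (t₀ + m + r)) u (fun i hi w => hu i hi w)
  have := T.proj
  have hcob₂ := hm _ (T.D (t₀ + m + r)) (T.D_D _)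
    (fun i => v i ∘ₗ powResMap I hs' i ∘ₗ u i - T.Φ r i)
    (fun i hi w => by
      simp only [LinearMap.sub_apply, LinearMap.comp_apply, map_sub, T.D_Φ]
      rw [hv i (by omega), powResMap_d I hs' 0 0, hu i hi])
    (fun w => by
      have h3 : aug ((v 0 ∘ₗ powResMap I hs' 0 ∘ₗ u 0 - T.Φ r 0) w) ∈ b (t₀ + m) := by
        refine (hs.trans (hanti (Nat.le_add_right _ _))) (Ideal.Quotient.eq_zero_iff_mem.1 ?_)
        simp only [LinearMap.sub_apply, LinearMap.comp_apply, map_sub, T.Φ_deg_zero]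
        rw [hv₀, resAug_powResMap I hs' _ (aug w) (hu₀ w), sub_self]
      obtain ⟨y, hy⟩ := (hK.mem_iff _ _).1 h3
      exact ⟨y, hK.aug_bij.1 hy⟩)
    top (fun w => by
      have h4 : Subsingleton (T.X (c + 1)) := hsub
      rw [Subsingleton.elim w 0, map_zero, map_zero])
  have hcob₃ := hcob₁.add (hcob₂.smul (-a))
  refine ⟨m + r, ?_⟩
  rw [← add_assoc, ← hK.isCob_iff]
  convert hcob₃ using 1
  ext w
  simp only [LinearMap.sub_apply, LinearMap.comp_apply, map_sub, LinearMap.smul_apply,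
    LinearMap.add_apply, hK.top_Φ, smul_eq_mul]
  ring

theorem IsKoszul.subsingleton_localCohomology (hK : IsKoszul T b π c aug top)
    (h₁ : ∀ t, ∃ s, I ^ s ≤ b t) (h₂ : ∀ s, ∃ r, b r ≤ I ^ s)
    (hone : ∀ t, ∃ k, π ^ k ∈ b (t + k)) :
    Subsingleton ((localCohomology I c).obj (ModuleCat.of A A)) := by
  refine subsingleton_of_forall_eq 0 fun z => ?_
  obtain ⟨s, f, hf⟩ := Represents.exists_rep z
  obtain ⟨k, hk⟩ := h₂ s
  obtain ⟨u, hu₀, hu⟩ := hK.exists_map_to_powRes c s k hk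
  obtain ⟨ρ, hρ⟩ := ProExactTower.exists_eq_smul_top hK.top_bij (f ∘ₗ u c)
  obtain ⟨j, hj⟩ := hone k
  obtain ⟨m₁, hm₁⟩ := hK.exists_map_of_powRes (I := I) c (k + j)
  obtain ⟨s₁, hs₁⟩ := h₁ (k + j + m₁)
  obtain ⟨s', hs', hle⟩ : ∃ s', s ≤ s' ∧ I ^ s' ≤ b (k + j + m₁) :=
    ⟨max s s₁, le_max_left _ _, (Ideal.pow_le_pow_right (le_max_right _ _)).trans hs₁⟩
  obtain ⟨v, hv₀, hv⟩ := hm₁ s' hle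
  have hcob₁ : ProExactTower.IsCob (T.D (k + j)) c ((π ^ j * ρ) • top) :=
    (hK.isCob_iff _ _).2 (Ideal.mul_mem_right _ _ hj)
  have hcob₂ := hcob₁.comp (dQ := (resTower (powRes I s')).D 0) v hv
  obtain ⟨m, hm⟩ := (resTower (powRes I s)).exists_isCob_comp c 0
  have := (resTower (powRes I s')).proj
  have hcob₃ := hm _ ((resTower (powRes I s')).D 0) ((resTower (powRes I s')).D_D _)
    (fun i => powResMap I hs' i - u i ∘ₗ T.Φ j i ∘ₗ v i)
    (fun i hi w => by
      simp only [LinearMap.sub_apply, LinearMap.comp_apply, map_sub]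
      rw [powResMap_d I hs' _ 0, ← hv i hi, ← T.D_Φ, ← hu i hi]
      rfl)
    (fun w => by
      refine (resAug_eq_zero_iff _ _ _).1 ?_
      simp only [LinearMap.sub_apply, LinearMap.comp_apply, map_sub, T.Φ_deg_zero]
      rw [hu₀, resAug_powResMap I hs' w (aug (v 0 w)) (hv₀ w).symm, sub_self])
    f (hf.apply_d 0)
  refine (hf.comp_powResMap hs').eq_zero 0 ?_
  convert hcob₃.add hcob₂ using 1
  ext w
  have h5 := LinearMap.congr_fun hρ (T.Φ j c (v c w))
  simp only [LinearMap.comp_apply, LinearMap.smul_apply, hK.top_Φ, smul_eq_mul] at h5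
  simp only [LinearMap.sub_apply, LinearMap.comp_apply, map_sub, LinearMap.smul_apply,
    LinearMap.add_apply, smul_eq_mul]
  change _ = f (powResMap I hs' c w) - f (u c (T.Φ j c (v c w))) + _
  rw [h5]
  ring

end Koszul

theorem antitone_span_range_pow {A : Type*} [CommRing A] {c : ℕ} (x : Fin c → A) :
    Antitone fun t : ℕ => Ideal.span (Set.range fun i => x i ^ t) := by
  intro t t' h
  change Ideal.span _ ≤ Ideal.span _
  rw [Ideal.span_le]
  rintro _ ⟨i, rfl⟩
  exact Ideal.mem_of_dvd _ (pow_dvd_pow (x i) h) (Ideal.subset_span (Set.mem_range_self i))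

section ArithmeticRank

variable {A : Type u} [CommRing A] [IsNoetherianRing A] {I : Ideal A} {c : ℕ} {x : Fin c → A}

theorem exists_pow_le_span_range_pow (hx : (Ideal.span (Set.range x)).radical = I.radical)
    (t : ℕ) : ∃ s, I ^ s ≤ Ideal.span (Set.range fun i => x i ^ t) := by
  refine Ideal.exists_pow_le_of_le_radical_of_fg ?_ (IsNoetherian.noetherian I)
  refine Ideal.le_radical.trans (hx.symm.le.trans (Ideal.radical_le_radical_iff.2 ?_))
  rw [Ideal.span_le]
  rintro _ ⟨i, rfl⟩
  exact ⟨t, Ideal.subset_span ⟨i, rfl⟩⟩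

theorem exists_span_range_pow_le_pow (hx : (Ideal.span (Set.range x)).radical = I.radical)
    (s : ℕ) : ∃ r, Ideal.span (Set.range fun i => x i ^ r) ≤ I ^ s := by
  obtain ⟨r, hr⟩ := Ideal.exists_pow_le_of_le_radical_of_fg
    (I := Ideal.span (Set.range x)) (J := I ^ s) (fun y hy => by
      obtain ⟨n, hn⟩ : y ∈ I.radical := hx ▸ Ideal.le_radical hy
      exact ⟨n * s, pow_mul y n s ▸ Ideal.pow_mem_pow hn s⟩) (IsNoetherian.noetherian _)
  refine ⟨r, le_trans ?_ hr⟩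
  rw [Ideal.span_le]
  rintro _ ⟨i, rfl⟩
  exact Ideal.pow_mem_pow (Ideal.subset_span (Set.mem_range_self i)) r

theorem mem_limColon_of_mem_annihilator_localCohomology
    (hx : (Ideal.span (Set.range x)).radical = I.radical) {a : A}
    (ha : a ∈ Module.annihilator A ((localCohomology I c).obj (ModuleCat.of A A))) (t : ℕ) :
    a ∈ limColon x t := by
  obtain ⟨T, aug, top, hK⟩ := ProExactTower.exists_isKoszul x
  obtain ⟨k, hk⟩ := hK.mul_pow_mem_of_forall_smul_eq_zero (antitone_span_range_pow x)
    (exists_pow_le_span_range_pow hx) (exists_span_range_pow_le_pow hx)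
    (Module.mem_annihilator.1 ha) t
  exact ⟨k, add_comm t k ▸ hk⟩

theorem exists_one_notMem_limColon_of_nontrivial_localCohomology
    (hx : (Ideal.span (Set.range x)).radical = I.radical)
    (h : Nontrivial ((localCohomology I c).obj (ModuleCat.of A A))) :
    ∃ t, (1 : A) ∉ limColon x t := by
  by_contra! hcon
  obtain ⟨T, aug, top, hK⟩ := ProExactTower.exists_isKoszul x
  refine not_subsingleton_iff_nontrivial.2 h (hK.subsingleton_localCohomology
    (exists_pow_le_span_range_pow hx) (exists_span_range_pow_le_pow hx) fun t => ?_)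
  obtain ⟨k, hk⟩ := hcon t
  exact ⟨k, by simpa only [one_mul, add_comm t k] using hk⟩

end ArithmeticRank

section FieldLift

variable {k B C : Type*} [Field k] [CommRing B] [CommRing C]

/-- `G` is the graph of a partial lift of `f : k → C` along `π : B → C`, compatible with
Frobenius. -/
structure IsPartialLift (π : B →+* C) (f : k →+* C) (p : ℕ) (G : Subring (k × B)) : Prop where
  map_eq : ∀ x ∈ G, π x.2 = f x.1
  eq_zero : ∀ x ∈ G, x.1 = 0 → x.2 = 0
  pow_mem : ∀ x : k × B, π x.2 = f x.1 → x ^ p ∈ G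

namespace IsPartialLift

variable {π : B →+* C} {f : k →+* C} {p : ℕ} {G : Subring (k × B)}

theorem isField (h : IsPartialLift π f p G) (hp : p ≠ 0) (hπ : Function.Surjective π) :
    IsField G where
  exists_pair_ne := ⟨0, 1, fun h01 => zero_ne_one (congrArg (fun x : G => x.1.1) h01)⟩
  mul_comm := mul_comm
  mul_inv_cancel {x} hx := by
    have hx1 : x.1.1 ≠ 0 := fun h0 => hx (Subtype.ext (Prod.ext h0 (h.eq_zero _ x.2 h0)))
    obtain ⟨w, hw⟩ := hπ (f x.1.1⁻¹)
    let z : G := x ^ (p - 1) * ⟨(x.1.1⁻¹, w) ^ p, h.pow_mem _ hw⟩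
    have h1 : (x * z - 1).1.1 = 0 := by
      change x.1.1 * (x.1.1 ^ (p - 1) * x.1.1⁻¹ ^ p) - 1 = 0
      rw [← mul_assoc, mul_pow_sub_one hp, ← mul_pow, mul_inv_cancel₀ hx1, one_pow, sub_self]
    exact ⟨z, sub_eq_zero.1 (Subtype.ext (Prod.ext h1 (h.eq_zero _ (x * z - 1).2 h1)))⟩

theorem exists_mem_of_maximal [CharP k p] (hp : p.Prime) (h : Maximal (IsPartialLift π f p) G)
    (hπ : Function.Surjective π) (b : k) : ∃ y, (b, y) ∈ G := by
  by_contra! hb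
  obtain ⟨y, hy⟩ := hπ (f b)
  have hG := h.prop
  let _ : Field G := (hG.isField hp.ne_zero hπ).toField
  let _ : Algebra G k := ((RingHom.fst k B).comp G.subtype).toAlgebra
  let _ : Algebra G (k × B) := G.subtype.toAlgebra
  let α : G := ⟨(b, y) ^ p, hG.pow_mem _ hy⟩
  have hirr : Irreducible (Polynomial.X ^ p - Polynomial.C α) := by
    refine X_pow_sub_C_irreducible_of_prime hp fun β hβ => hb β.1.2 ?_
    have h1 : β.1.1 ^ p = b ^ p := congrArg (fun x : G => x.1.1) hβ
    have := Fact.mk hp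
    have h2 : β.1.1 = b := frobenius_inj k p h1
    exact h2 ▸ β.2
  have hmin : Polynomial.X ^ p - Polynomial.C α = minpoly G b :=
    minpoly.eq_of_irreducible_of_monic hirr
      (by simp only [map_sub, map_pow, Polynomial.aeval_X, Polynomial.aeval_C]; exact sub_self _)
      (Polynomial.monic_X_pow_sub_C _ hp.ne_zero)
  let G' : Subring (k × B) := (Polynomial.aeval (R := G) ((b, y) : k × B)).toRingHom.range
  have hle : G ≤ G' := fun x hx => ⟨Polynomial.C ⟨x, hx⟩, Polynomial.aeval_C _ _⟩
  have hG' : IsPartialLift π f p G' := by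
    refine ⟨?_, ?_, fun x hx => hle (hG.pow_mem x hx)⟩
    · rintro _ ⟨P, rfl⟩
      change (π.comp (RingHom.snd k B)) (Polynomial.aeval ((b, y) : k × B) P) =
        (f.comp (RingHom.fst k B)) (Polynomial.aeval ((b, y) : k × B) P)
      rw [Polynomial.aeval_def, Polynomial.hom_eval₂, Polynomial.hom_eval₂]
      have h2 : (π.comp (RingHom.snd k B)).comp (algebraMap G (k × B)) =
          (f.comp (RingHom.fst k B)).comp (algebraMap G (k × B)) :=
        RingHom.ext fun x => hG.map_eq _ x.2
      rw [h2]
      congr 1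
    · rintro _ ⟨P, rfl⟩ h0
      change (RingHom.fst k B) (Polynomial.aeval ((b, y) : k × B) P) = 0 at h0
      change (Polynomial.aeval ((b, y) : k × B) P).2 = 0
      rw [Polynomial.aeval_def, Polynomial.hom_eval₂] at h0
      obtain ⟨Q, rfl⟩ : (Polynomial.X ^ p - Polynomial.C α) ∣ P := hmin ▸ minpoly.dvd G b h0
      rw [map_mul]
      have h3 : Polynomial.aeval ((b, y) : k × B) (Polynomial.X ^ p - Polynomial.C α) = 0 := by
        simp only [map_sub, map_pow, Polynomial.aeval_X, Polynomial.aeval_C]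
        exact sub_self _
      rw [h3, zero_mul]
      rfl
  exact hb y (h.le_of_ge hG' hle ⟨Polynomial.X, Polynomial.aeval_X _⟩)

end IsPartialLift

theorem exists_lift_of_field (p : ℕ) [Fact p.Prime] [CharP k p] (hpB : (p : B) = 0)
    {π : B →+* C} (hπ : Function.Surjective π)
    (hsq : ∀ y z, π y = 0 → π z = 0 → y * z = 0) (f : k →+* C) :
    ∃ g : k →+* B, π.comp g = f := by
  have hp : p.Prime := Fact.out
  have : CharP (k × B) p := ⟨fun n => ⟨fun h => (CharP.cast_eq_zero_iff k p n).1
      (congrArg Prod.fst h), fun ⟨m, hm⟩ => by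
    rw [hm]; exact Prod.ext (by simp) (by simp [hpB])⟩⟩
  let E : Subring (k × B) := RingHom.eqLocus (π.comp (RingHom.snd k B)) (f.comp (RingHom.fst k B))
  have h₀ : IsPartialLift π f p (E.map (frobenius (k × B) p)) := by
    refine ⟨?_, ?_, fun x hx => ⟨x, hx, rfl⟩⟩
    · rintro _ ⟨x, hx, rfl⟩
      have hx' : π x.2 = f x.1 := hx
      simp [frobenius_def, hx']
    · rintro _ ⟨x, hx, rfl⟩ h0
      have hx' : π x.2 = f x.1 := hx
      have h1 : x.1 = 0 := pow_eq_zero_iff hp.ne_zero |>.1 h0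
      rw [h1, map_zero] at hx'
      change x.2 ^ p = 0
      rw [← Nat.sub_add_cancel hp.two_le, pow_add, pow_two, hsq _ _ hx' hx', mul_zero]
  obtain ⟨G, -, hG⟩ := zorn_le_nonempty₀ {G | IsPartialLift π f p G} (by
    intro c hc hchain G hG
    have hmem : ∀ {x}, x ∈ sSup c ↔ ∃ s ∈ c, x ∈ s :=
      Subring.mem_sSup_of_directedOn ⟨G, hG⟩ hchain.directedOn
    refine ⟨sSup c, ⟨?_, ?_, ?_⟩, fun z hz => le_sSup hz⟩
    · intro x hx
      obtain ⟨s, hs, hxs⟩ := hmem.1 hx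
      exact (hc hs).map_eq x hxs
    · intro x hx
      obtain ⟨s, hs, hxs⟩ := hmem.1 hx
      exact (hc hs).eq_zero x hxs
    · intro x hx
      exact hmem.2 ⟨G, hG, (hc hG).pow_mem x hx⟩) _ h₀
  have hbij : Function.Bijective ((RingHom.fst k B).comp G.subtype) := by
    refine ⟨(injective_iff_map_eq_zero _).2 fun x hx => ?_, fun b => ?_⟩
    · exact Subtype.ext (Prod.ext hx (hG.prop.eq_zero _ x.2 hx))
    · obtain ⟨y, hy⟩ := IsPartialLift.exists_mem_of_maximal hp hG hπ b
      exact ⟨⟨_, hy⟩, rfl⟩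
  let e := RingEquiv.ofBijective _ hbij
  refine ⟨((RingHom.snd k B).comp G.subtype).comp e.symm.toRingHom, RingHom.ext fun b => ?_⟩
  obtain ⟨x, rfl⟩ := e.surjective b
  have := hG.prop.map_eq _ x.2
  change π (e.symm (e x)).1.2 = f x.1.1
  rw [e.symm_apply_apply, this]

theorem FormallySmooth.zmod_field (k : Type u) [Field k] (p : ℕ) [Fact p.Prime] [CharP k p]
    [Algebra (ZMod p) k] : Algebra.FormallySmooth (ZMod p) k := by
  refine Algebra.FormallySmooth.of_comp_surjective fun B _ _ I hI f => ?_
  have hpB : (p : B) = 0 := by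
    rw [← map_natCast (algebraMap (ZMod p) B), CharP.cast_eq_zero, map_zero]
  obtain ⟨g, hg⟩ := exists_lift_of_field p hpB (Ideal.Quotient.mk_surjective (I := I))
    (fun y z hy hz => by
      have := Ideal.mul_mem_mul (Ideal.Quotient.eq_zero_iff_mem.1 hy)
        (Ideal.Quotient.eq_zero_iff_mem.1 hz)
      rwa [← pow_two, hI] at this) f.toRingHom
  refine ⟨⟨g, fun r => RingHom.congr_fun (Subsingleton.elim (g.comp (algebraMap (ZMod p) k))
    (algebraMap (ZMod p) B)) r⟩, ?_⟩
  ext b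
  exact RingHom.congr_fun hg b

end FieldLift

theorem exists_surjective_mvPowerSeries {K S : Type*} [CommRing K] [CommRing S] [Algebra K S]
    {n : ℕ} (y : Fin n → S) [IsAdicComplete (Ideal.span (Set.range y)) S]
    (hK : Function.Surjective ((Ideal.Quotient.mk (Ideal.span (Set.range y))).comp
      (algebraMap K S))) :
    ∃ f : MvPowerSeries (Fin n) K →+* S, Function.Surjective f := by
  set J := Ideal.span (Set.range y) with hJ
  let g : MvPolynomial (Fin n) K →+* S := (MvPolynomial.aeval y).toRingHom
  have hg : ∀ m, MvPolynomial.idealOfVars (Fin n) K ^ m ≤ (J ^ m).comap g := by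
    intro m
    rw [← Ideal.map_le_iff_le_comap, Ideal.map_pow]
    refine Ideal.pow_right_mono ?_ m
    rw [MvPolynomial.idealOfVars, Ideal.map_span, Ideal.span_le]
    rintro _ ⟨_, ⟨i, rfl⟩, rfl⟩
    exact Ideal.subset_span ⟨i, (MvPolynomial.aeval_X _ _).symm⟩
  let f (m : ℕ) : MvPowerSeries (Fin n) K →+* S ⧸ J ^ m :=
    (Ideal.quotientMap (J ^ m) g (hg m)).comp (MvPowerSeries.truncTotalAlgHom (Fin n) K m).toRingHom
  have hf_apply : ∀ m p, f m p = Ideal.Quotient.mk (J ^ m) (g (p.truncTotal m)) :=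
    fun m p => Ideal.quotientMap_mk (I := J ^ m) (f := g) (H := hg m)
  have hf : ∀ {m l : ℕ} (hle : m ≤ l), (Ideal.Quotient.factorPow J hle).comp (f l) = f m := by
    intro m l hle
    ext p
    rw [RingHom.comp_apply, hf_apply, hf_apply]
    refine Ideal.Quotient.eq.2 ?_
    rw [← map_sub]
    exact hg m (MvPowerSeries.truncTotal_sub_truncTotal_mem_pow_idealOfVars hle le_rfl p)
  let F := IsAdicComplete.liftRingHom J f hf
  have hF : ∀ m p, Ideal.Quotient.mk (J ^ m) (F p) =
      Ideal.Quotient.mk (J ^ m) (g (p.truncTotal m)) :=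
    fun m p => (IsAdicComplete.mk_liftRingHom J f hf m p).trans (hf_apply m p)
  have hpoly : ∀ q : MvPolynomial (Fin n) K, F q = g q := by
    intro q
    refine IsHausdorff.eq_iff_smodEq (I := J).2 fun m => ?_
    rw [SModEq.sub_mem, smul_eq_mul, Ideal.mul_top, ← Ideal.Quotient.eq, hF, Ideal.Quotient.eq,
      ← map_sub]
    refine hg m ((MvPolynomial.mem_pow_idealOfVars_iff' ..).2 fun x hx => ?_)
    simp [MvPowerSeries.coeff_truncTotal _ hx]
  have hX : (Ideal.span (Set.range MvPowerSeries.X)).map F = J := by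
    rw [Ideal.map_span, ← Set.range_comp, hJ]
    congr 2
    ext i
    rw [Function.comp_apply, ← MvPolynomial.coe_X, hpoly]
    exact MvPolynomial.aeval_X _ _
  refine ⟨F, ?_⟩
  have : IsHausdorff
      ((Ideal.span (Set.range (MvPowerSeries.X (σ := Fin n) (R := K)))).map F) S := by
    rw [hX]; infer_instance
  refine surjective_of_mk_map_comp_surjective
    (I := Ideal.span (Set.range (MvPowerSeries.X (σ := Fin n) (R := K)))) F ?_
  rw [hX]
  intro z
  obtain ⟨k, rfl⟩ := hK z
  refine ⟨MvPowerSeries.C k, ?_⟩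
  rw [RingHom.comp_apply, ← MvPolynomial.coe_C, hpoly]
  exact congrArg _ (MvPolynomial.aeval_C (R := K) y k)

theorem MvPowerSeries.exists_eq_sum_monomial_mul_pow {K : Type*} [Field K] (p : ℕ) [Fact p.Prime]
    [CharP K p] [PerfectRing K p] {σ : Type*} [Fintype σ] [DecidableEq σ] (f : MvPowerSeries σ K) :
    ∃ g : (σ → Fin p) → MvPowerSeries σ K,
      f = ∑ α, g α ^ p * monomial (Finsupp.equivFunOnFinite.symm fun i => (α i : ℕ)) 1 := by
  have hp : p ≠ 0 := (Fact.out : p.Prime).ne_zero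
  let e (α : σ → Fin p) : σ →₀ ℕ := Finsupp.equivFunOnFinite.symm fun i => (α i : ℕ)
  let h (α : σ → Fin p) : MvPowerSeries σ K := fun m => coeff (p • m + e α) f
  have hh : ∀ α m, coeff m (h α) = coeff (p • m + e α) f := fun α m => rfl
  have hpow : ∀ α, (map ((frobeniusEquiv K p).symm : K →+* K) (h α)) ^ p = expand p hp (h α) := by
    intro α
    rw [← map_frobenius_expand p hp, map_expand]
    congr 1
    ext m
    simp
  refine ⟨fun α => map ((frobeniusEquiv K p).symm : K →+* K) (h α), ?_⟩
  simp_rw [hpow]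
  ext d
  have hpos : 0 < p := Nat.pos_of_ne_zero hp
  let α₀ : σ → Fin p := fun i => ⟨d i % p, Nat.mod_lt _ hpos⟩
  let m₀ : σ →₀ ℕ := Finsupp.equivFunOnFinite.symm fun i => d i / p
  have hd : d = p • m₀ + e α₀ := by
    ext i
    simp [m₀, e, α₀, Nat.div_add_mod]
  rw [map_sum, Finset.sum_eq_single α₀]
  · change _ = coeff d (_ * monomial (e α₀) 1)
    rw [hd, coeff_add_mul_monomial, mul_one, coeff_expand_smul, hh]
  · intro α _ hα
    change coeff d (_ * monomial (e α) 1) = 0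
    rw [coeff_mul_monomial]
    split_ifs with hle
    · rw [mul_one]
      obtain ⟨i, hi⟩ := Function.ne_iff.1 hα
      refine coeff_expand_of_not_dvd p hp _ (i := i) fun hdvd => hi ?_
      have hle' : (α i : ℕ) ≤ d i := hle i
      have hdvd' : p ∣ d i - α i := hdvd
      refine Fin.ext ?_
      change (α i : ℕ) = d i % p
      rw [← Nat.mod_eq_of_lt (α i).isLt]
      exact (Nat.modEq_iff_dvd' hle').2 hdvd'
    · rfl
  · exact fun h => absurd (Finset.mem_univ _) h

theorem RingHom.Finite.of_forall_eq_sum {R S ι : Type*} [CommRing R] [CommRing S] [Fintype ι]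
    (φ : R →+* S) (b : ι → S) (h : ∀ s, ∃ c : ι → R, s = ∑ i, φ (c i) * b i) : φ.Finite := by
  algebraize [φ]
  refine Module.Finite.of_surjective (Fintype.linearCombination R b) fun s => ?_
  obtain ⟨c, rfl⟩ := h s
  exact ⟨c, by
    simp [Fintype.linearCombination_apply, Algebra.smul_def, RingHom.algebraMap_toAlgebra]⟩

theorem frobenius_finite_of_surjective_mvPowerSeries {K S : Type*} [Field K] [CommRing S] (p : ℕ)
    [Fact p.Prime] [CharP K p] [PerfectRing K p] [CharP S p] {n : ℕ}
    (f : MvPowerSeries (Fin n) K →+* S) (hf : Function.Surjective f) :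
    (frobenius S p).Finite := by
  refine .of_forall_eq_sum _ (fun α : Fin n → Fin p =>
    f (MvPowerSeries.monomial (Finsupp.equivFunOnFinite.symm fun i => (α i : ℕ)) 1)) fun s => ?_
  obtain ⟨q, rfl⟩ := hf s
  obtain ⟨g, hg⟩ := MvPowerSeries.exists_eq_sum_monomial_mul_pow p q
  refine ⟨fun α => f (g α), ?_⟩
  conv_lhs => rw [hg]
  simp only [map_sum, map_mul, map_pow, frobenius_def]

theorem map_mem_limColon {R S : Type*} [CommRing R] [CommRing S] (f : R →+* S) {c : ℕ}
    {x : Fin c → R} {t : ℕ} {u : R} (hu : u ∈ limColon x t) :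
    f u ∈ limColon (fun i => f (x i)) t := by
  obtain ⟨k, hk⟩ := hu
  refine ⟨k, ?_⟩
  have h := Ideal.mem_map_of_mem f hk
  rw [Ideal.map_span, ← Set.range_comp] at h
  simpa [Function.comp_def] using h

section

variable {A B : Type*} [CommRing A] [CommRing B] [Algebra A B]

/-- If `B` is flat over `A`, a multiplier of `a` into `JB` is a combination of multipliers of `a`
into `J`. -/
theorem mem_map_of_mul_algebraMap_mem_map [Module.Flat A B] {J J' : Ideal A} (hJ : J.FG) {a : A}
    (h : ∀ r, r * a ∈ J → r ∈ J') {b : B} (hb : b * algebraMap A B a ∈ J.map (algebraMap A B)) :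
    b ∈ J'.map (algebraMap A B) := by
  obtain ⟨n, r, rfl⟩ := Submodule.fg_iff_exists_fin_generating_family.1 hJ
  rw [← Ideal.span, Ideal.map_span, ← Set.range_comp, Ideal.mem_span_range_iff_exists_fun] at hb
  obtain ⟨d, hd⟩ := hb
  obtain ⟨k, e, y, hy, he⟩ := Module.Flat.isTrivialRelation_of_sum_smul_eq_zero
    (f := fun o : Option (Fin n) => o.elim a fun j => -r j)
    (x := fun o : Option (Fin n) => o.elim b d) (by
      simp [Fintype.sum_option, Algebra.smul_def, mul_comm _ b, ← hd, mul_comm (d _)])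
  have hb : b = ∑ l, e none l • y l := hy none
  rw [hb]
  refine Ideal.sum_mem _ fun l _ => ?_
  rw [Algebra.smul_def]
  refine Ideal.mul_mem_right _ _ (Ideal.mem_map_of_mem _ (h _ ?_))
  have hl := he l
  simp only [Fintype.sum_option, Option.elim, neg_mul, Finset.sum_neg_distrib] at hl
  rw [mul_comm, add_neg_eq_zero.1 hl]
  exact Ideal.sum_mem _ fun j _ => Ideal.mul_mem_right _ _ (Ideal.subset_span ⟨j, rfl⟩)

variable [IsNoetherianRing A] [IsLocalRing A]

local notation "𝔪" => IsLocalRing.maximalIdeal A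

theorem exists_forall_mem_maximalIdeal_pow_of_mul_mem [IsDomain A] {a : A} (ha : a ≠ 0) :
    ∃ k, ∀ n r, r * a ∈ 𝔪 ^ (n + k) → r ∈ 𝔪 ^ n := by
  obtain ⟨k, hk⟩ := Ideal.exists_pow_inf_eq_pow_smul 𝔪 (Ideal.span {a})
  refine ⟨k, fun n r hr => ?_⟩
  have h : r * a ∈ 𝔪 ^ (n + k) • (⊤ : Ideal A) ⊓ Ideal.span {a} := by
    refine ⟨?_, Ideal.mul_mem_left _ _ (Ideal.mem_span_singleton_self a)⟩
    rwa [smul_eq_mul, Ideal.mul_top]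
  rw [hk _ (Nat.le_add_left k n), Nat.add_sub_cancel] at h
  have h' : r * a ∈ 𝔪 ^ n * Ideal.span {a} := Ideal.mul_mono_right inf_le_right h
  obtain ⟨z, hz, hza⟩ := Ideal.mem_mul_span_singleton.1 h'
  rwa [← mul_right_cancel₀ ha hza]

local notation "𝔪B" => Ideal.map (algebraMap A B) 𝔪

theorem eq_zero_of_mul_algebraMap_adicCompletion [IsDomain A] [Module.Flat A B] {a : A}
    (ha : a ≠ 0) (s : AdicCompletion 𝔪B B)
    (hs : s * algebraMap B (AdicCompletion 𝔪B B) (algebraMap A B a) = 0) : s = 0 := by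
  obtain ⟨k, hk⟩ := exists_forall_mem_maximalIdeal_pow_of_mul_mem ha
  refine AdicCompletion.ext_evalₐ fun n => ?_
  obtain ⟨b, rfl⟩ := AdicCompletion.mk_surjective 𝔪B B s
  have h := congrArg (AdicCompletion.evalₐ 𝔪B (n + k)) hs
  rw [map_mul, map_zero, AdicCompletion.evalₐ_mk, AlgHom.commutes,
    Ideal.Quotient.algebraMap_eq, ← map_mul, Ideal.Quotient.eq_zero_iff_mem, ← Ideal.map_pow] at h
  have h' := mem_map_of_mul_algebraMap_mem_map (IsNoetherian.noetherian _) (hk n) h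
  rw [Ideal.map_pow, ← Ideal.Quotient.eq_zero_iff_mem] at h'
  rw [map_zero, ← h', AdicCompletion.evalₐ_mk, eq_comm, Ideal.Quotient.eq]
  exact Ideal.mul_top (𝔪B ^ n) ▸ (Submodule.Quotient.eq _).1
    (AdicCompletion.AdicCauchySequence.mk_eq_mk (Nat.le_add_right n k) b)

theorem one_mem_limColon_of_one_mem_limColon_adicCompletion [Module.FaithfullyFlat A B] {c : ℕ}
    {x : Fin c → A} {t : ℕ}
    (h : 1 ∈ limColon
      (fun i => algebraMap B (AdicCompletion 𝔪B B) (algebraMap A B (x i))) t) :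
    1 ∈ limColon x t := by
  obtain ⟨k, hk⟩ := h
  refine ⟨k, ?_⟩
  set J := Ideal.span (Set.range fun i => x i ^ (k + t))
  have key : ∀ n, (∏ i, x i) ^ k ∈ J ⊔ 𝔪 ^ n := by
    intro n
    rw [← Ideal.comap_map_eq_self_of_faithfullyFlat (B := B) (J ⊔ 𝔪 ^ n), Ideal.mem_comap,
      Ideal.map_sup, Ideal.map_pow]
    have h := Ideal.mem_map_of_mem (AdicCompletion.evalₐ 𝔪B n) hk
    rw [Ideal.map_span, ← Set.range_comp] at h
    simp only [Function.comp_def, map_pow, map_prod, one_mul, AlgHom.commutes,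
      Ideal.Quotient.algebraMap_eq] at h
    have hJ : Ideal.span (Set.range fun i =>
        Ideal.Quotient.mk (𝔪B ^ n) (algebraMap A B (x i)) ^ (k + t)) =
        (J.map (algebraMap A B)).map (Ideal.Quotient.mk (𝔪B ^ n)) := by
      rw [Ideal.map_span, Ideal.map_span, ← Set.range_comp, ← Set.range_comp]
      simp [Function.comp_def]
    have h' : algebraMap A B ((∏ i, x i) ^ k) ∈
        ((J.map (algebraMap A B)).map (Ideal.Quotient.mk (𝔪B ^ n))).comap
          (Ideal.Quotient.mk (𝔪B ^ n)) := by
      rw [Ideal.mem_comap, ← hJ]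
      simpa using h
    rwa [Ideal.comap_map_of_surjective _ Ideal.Quotient.mk_surjective,
      ← RingHom.ker_eq_comap_bot, Ideal.mk_ker] at h'
  rw [one_mul, ← Ideal.Quotient.eq_zero_iff_mem]
  refine IsHausdorff.haus (I := 𝔪) (M := A ⧸ J) inferInstance _ fun n => ?_
  rw [SModEq.zero]
  obtain ⟨u, hu, v, hv, huv⟩ := Submodule.mem_sup.1 (key n)
  rw [← huv, map_add, Ideal.Quotient.eq_zero_iff_mem.2 hu, zero_add]
  have := Submodule.smul_mem_smul hv (Submodule.mem_top (x := (1 : A ⧸ J)))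
  rwa [Algebra.smul_def, mul_one] at this

variable (A B) in
theorem isNoetherianRing_and_frobenius_finite_adicCompletion (p : ℕ) [Fact p.Prime]
    {K : Type*} [Field K] [CharP K p] [PerfectRing K p] [Algebra K B]
    [CharP (AdicCompletion 𝔪B B) p]
    (hK : Function.Surjective ((Ideal.Quotient.mk 𝔪B).comp (algebraMap K B))) :
    IsNoetherianRing (AdicCompletion 𝔪B B) ∧ (frobenius (AdicCompletion 𝔪B B) p).Finite := by
  have hfg : (𝔪B).FG := Ideal.FG.map (IsNoetherian.noetherian 𝔪) _
  obtain ⟨n, y, hy⟩ := Submodule.fg_iff_exists_fin_generating_family.1 hfg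
  let z (i : Fin n) := algebraMap B (AdicCompletion 𝔪B B) (y i)
  have hz : Ideal.span (Set.range z) = (𝔪B).map (algebraMap B (AdicCompletion 𝔪B B)) := by
    conv_rhs => arg 2; rw [← hy]
    rw [← Ideal.span, Ideal.map_span, ← Set.range_comp]
    rfl
  have : IsAdicComplete (Ideal.span (Set.range z)) (AdicCompletion 𝔪B B) := by
    rw [hz]; exact AdicCompletion.isAdicComplete_self _ hfg
  let _ : Algebra K (AdicCompletion 𝔪B B) :=
    ((algebraMap B (AdicCompletion 𝔪B B)).comp (algebraMap K B)).toAlgebra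
  obtain ⟨f, hf⟩ := exists_surjective_mvPowerSeries (K := K) z (by
    intro q
    obtain ⟨s, rfl⟩ := Ideal.Quotient.mk_surjective q
    obtain ⟨c, hc⟩ := hK (AdicCompletion.evalOneₐ 𝔪B s)
    refine ⟨c, ?_⟩
    rw [RingHom.comp_apply, Ideal.Quotient.eq, hz, ← AdicCompletion.ker_evalOneₐ_eq_map _ hfg,
      RingHom.mem_ker, map_sub, sub_eq_zero]
    exact hc)
  exact ⟨isNoetherianRing_of_surjective _ _ f hf,
    frobenius_finite_of_surjective_mvPowerSeries p f hf⟩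

end

open scoped TensorProduct

/-- A complete local ring of equal characteristic `p` contains a coefficient field. -/
theorem exists_ringHom_adicCompletion_section {A : Type*} [CommRing A] (p : ℕ) [Fact p.Prime]
    [CharP A p] (m : Ideal A) [m.IsMaximal] :
    ∃ σ : A ⧸ m →+* AdicCompletion m A, ∀ z, AdicCompletion.evalOneₐ m (σ z) = z := by
  let _ : Algebra (ZMod p) A := ZMod.algebra A p
  let _ : Field (A ⧸ m) := Ideal.Quotient.field m
  have : CharP (A ⧸ m) p := charP_of_injective_algebraMap (algebraMap (ZMod p) (A ⧸ m)).injective p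
  have := FormallySmooth.zmod_field (A ⧸ m) p
  obtain ⟨g, hg⟩ := Algebra.FormallySmooth.exists_adicCompletionEvalOneₐ_comp_eq (R := ZMod p)
    (I := m) (AlgHom.id (ZMod p) (A ⧸ m))
  exact ⟨g.toRingHom, fun z => DFunLike.congr_fun hg z⟩

/-- If `C` is a flat algebra over the local ring `A` with coefficient field `k`, then adjoining the
algebraic closure of `k` to `C` gives a faithfully flat algebra with a perfect coefficient field. -/
theorem exists_faithfullyFlat_of_section {A C k : Type u} [CommRing A] [IsLocalRing A] [CommRing C]
    [Algebra A C] [Module.Flat A C] [Field k] (p : ℕ) [Fact p.Prime] [CharP k p]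
    (σ : k →+* C) (π : C →+* k) (hσ : ∀ z, π (σ z) = z)
    (hπ : RingHom.ker π = (IsLocalRing.maximalIdeal A).map (algebraMap A C)) :
    ∃ (K B : Type u) (_ : Field K) (_ : CommRing B) (_ : Algebra A B) (_ : Algebra K B),
      CharP K p ∧ PerfectRing K p ∧ Module.FaithfullyFlat A B ∧
      Function.Surjective ((Ideal.Quotient.mk ((IsLocalRing.maximalIdeal A).map
        (algebraMap A B))).comp (algebraMap K B)) := by
  let _ : Algebra k C := σ.toAlgebra
  let K := AlgebraicClosure k
  have : CharP K p := charP_of_injective_algebraMap (algebraMap k K).injective p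
  have : SMulCommClass k A C := ⟨fun x a c => by
    simp only [Algebra.smul_def, mul_left_comm]⟩
  have hcomm (a : A) : algebraMap A (C ⊗[k] K) a = algebraMap A C a ⊗ₜ 1 := rfl
  let _ : Algebra K (C ⊗[k] K) := Algebra.TensorProduct.rightAlgebra
  have hK (y : K) : algebraMap K (C ⊗[k] K) y = 1 ⊗ₜ y := rfl
  have hflat : Module.Flat A (C ⊗[k] K) := Module.Flat.trans A C _
  let πk : C →ₐ[k] k := { π with commutes' := hσ }
  let ψ : C ⊗[k] K →ₐ[k] K := Algebra.TensorProduct.lift ((Algebra.ofId k K).comp πk)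
    (AlgHom.id k K) fun _ _ => mul_comm _ _
  have hψ : (IsLocalRing.maximalIdeal A).map (algebraMap A (C ⊗[k] K)) ≤ RingHom.ker ψ := by
    rw [Ideal.map_le_iff_le_comap]
    intro a ha
    have h : π (algebraMap A C a) = 0 := hπ.ge (Ideal.mem_map_of_mem _ ha)
    have h' : πk (algebraMap A C a) = 0 := h
    have hψa : ψ (algebraMap A C a ⊗ₜ 1) =
        (Algebra.ofId k K).comp πk (algebraMap A C a) * AlgHom.id k K 1 :=
      Algebra.TensorProduct.lift_tmul _ _ _ _ _
    rw [Ideal.mem_comap, hcomm, RingHom.mem_ker, hψa, AlgHom.comp_apply, h', map_zero, zero_mul]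
  refine ⟨K, C ⊗[k] K, inferInstance, inferInstance, inferInstance, inferInstance,
    inferInstance, inferInstance, ⟨fun {m} hm htop => ?_⟩, fun q => ?_⟩
  · rw [IsLocalRing.eq_maximalIdeal hm] at htop
    have h1 : (1 : C ⊗[k] K) ∈ (IsLocalRing.maximalIdeal A).map (algebraMap A (C ⊗[k] K)) := by
      rw [← Submodule.restrictScalars_mem A, ← Ideal.smul_top_eq_map, htop]
      trivial
    simpa using hψ h1
  · obtain ⟨q, rfl⟩ := Ideal.Quotient.mk_surjective q
    induction q with
    | zero => exact ⟨0, by simp⟩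
    | add x y hx hy =>
      obtain ⟨a, ha⟩ := hx
      obtain ⟨b, hb⟩ := hy
      exact ⟨a + b, by rw [map_add, ha, hb, map_add]⟩
    | tmul c y =>
      refine ⟨π c • y, ?_⟩
      rw [RingHom.comp_apply, Ideal.Quotient.eq, hK, ← TensorProduct.smul_tmul,
        ← TensorProduct.sub_tmul]
      have h : π c • (1 : C) - c ∈ (IsLocalRing.maximalIdeal A).map (algebraMap A C) := by
        rw [← hπ, RingHom.mem_ker, map_sub, sub_eq_zero, Algebra.smul_def, mul_one]
        exact hσ _
      have h' := Ideal.mem_map_of_mem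
        (Algebra.TensorProduct.includeLeftRingHom : C →+* C ⊗[k] K) h
      rw [Ideal.map_map] at h'
      have e : (π c • (1 : C) - c) ⊗ₜ[k] y = ((π c • (1 : C) - c) ⊗ₜ 1) * (1 ⊗ₜ y) := by
        rw [Algebra.TensorProduct.tmul_mul_tmul, mul_one, one_mul]
      rw [e]
      exact Ideal.mul_mem_right _ _ h'

theorem exists_faithfullyFlat_surjective_perfect (A : Type u) [CommRing A] [IsLocalRing A]
    [IsNoetherianRing A] (p : ℕ) [Fact p.Prime] [CharP A p] :
    ∃ (K B : Type u) (_ : Field K) (_ : CommRing B) (_ : Algebra A B) (_ : Algebra K B),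
      CharP K p ∧ PerfectRing K p ∧ Module.FaithfullyFlat A B ∧
      Function.Surjective ((Ideal.Quotient.mk ((IsLocalRing.maximalIdeal A).map
        (algebraMap A B))).comp (algebraMap K B)) := by
  let m := IsLocalRing.maximalIdeal A
  obtain ⟨σ, hσ⟩ := exists_ringHom_adicCompletion_section p m
  let _ : Field (A ⧸ m) := Ideal.Quotient.field m
  let _ : Algebra (ZMod p) A := ZMod.algebra A p
  have : CharP (A ⧸ m) p := charP_of_injective_algebraMap (algebraMap (ZMod p) (A ⧸ m)).injective p
  have := AdicCompletion.flat_of_isNoetherian m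
  exact exists_faithfullyFlat_of_section p σ (AdicCompletion.evalOneₐ m).toRingHom hσ
    (AdicCompletion.ker_evalOneₐ_eq_map m (IsNoetherian.noetherian m))

/-- **Hochster–Jeffries.** Let `(A, 𝔪)` be a Noetherian local domain of prime characteristic
`p`, `I` an ideal with cohomological dimension `c = lcd_A(I)` (i.e. `H^c_I(A) ≠ 0` and
`H^k_I(A) = 0` for `k > c`).  If `c` equals the arithmetic rank of `I` (i.e. `I` is, up to
radical, generated by `c` elements, and by no fewer), then `H^c_I(A)` is a faithful
`A`-module. -/
theorem hochster_jeffries_faithful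
    (A : Type) [CommRing A] [IsDomain A] [IsNoetherianRing A] [IsLocalRing A]
    (p : ℕ) (hp : p.Prime) [CharP A p]
    (I : Ideal A) (c : ℕ)
    (hnon : Nontrivial ((localCohomology I c).obj (ModuleCat.of A A)))
    (hvan : ∀ k : ℕ, c < k → Subsingleton ((localCohomology I k).obj (ModuleCat.of A A)))
    (hara : ∃ x : Fin c → A, (Ideal.span (Set.range x)).radical = I.radical)
    (hara_min : ∀ (ℓ : ℕ) (x : Fin ℓ → A),
      (Ideal.span (Set.range x)).radical = I.radical → c ≤ ℓ) :
    Module.annihilator A ((localCohomology I c).obj (ModuleCat.of A A)) = ⊥ := by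
  have : Fact p.Prime := ⟨hp⟩
  obtain ⟨x, hx⟩ := hara
  refine (Submodule.eq_bot_iff _).2 fun a ha => by_contra fun ha0 => ?_
  obtain ⟨t, ht⟩ := exists_one_notMem_limColon_of_nontrivial_localCohomology hx hnon
  obtain ⟨K, B, _, _, _, _, _, _, _, hK⟩ := exists_faithfullyFlat_surjective_perfect A p
  let J := (IsLocalRing.maximalIdeal A).map (algebraMap A B)
  let ι : A →+* AdicCompletion J B := (algebraMap B (AdicCompletion J B)).comp (algebraMap A B)
  have hreg : ∀ s, s * ι a = 0 → s = 0 := eq_zero_of_mul_algebraMap_adicCompletion ha0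
  refine ht (one_mem_limColon_of_one_mem_limColon_adicCompletion (B := B) ?_)
  rcases subsingleton_or_nontrivial (AdicCompletion J B) with h | _
  · exact ⟨0, (congrArg (· ∈ _) (Subsingleton.elim (α := AdicCompletion J B) 0 _)).mp
      (zero_mem (Ideal.span _))⟩
  · let _ : Algebra (ZMod p) A := ZMod.algebra A p
    have : CharP (AdicCompletion J B) p :=
      charP_of_injective_ringHom (ι.comp (algebraMap (ZMod p) A)).injective p
    obtain ⟨_, hF⟩ := isNoetherianRing_and_frobenius_finite_adicCompletion A B p hK
    exact one_mem_limColon_of_forall_mem_of_frobenius_finite p hF _ (ι a) hreg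
      (fun t => map_mem_limColon ι (mem_limColon_of_mem_annihilator_localCohomology hx ha t)) t
end
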